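/- arXiv:1506.06843 — 4 statements merged into one kernel-verified Lean document; each statement's English description precedes it below -/
import Mathlib

section
/- Let φ̃ : ℂ → ℂ be holomorphic on the closed strip {s : -1/2 ≤ Re s ≤ 2} except for a simple pole at s = 0 with residue 1, and suppose there is a constant C such that |φ̃(s)| ≤ C(1+|Im s|)^{-3} for all s in the strip with |Im s| ≥ 1. Let ξ, η ∈ ℂ with ξ ≠ 0, η ≠ 0, |Re ξ| ≤ 1/10, |Re η| ≤ 1/10, and φ̃(-ξ) = φ̃(-η) = 0. Define φ(y) = (1/2π) ∫_ℝ φ̃(1+it) y^{-1-it} dt for y > 0, and S_Q(ξ,η) = Σ_{1 ≤ M ≤ N, gcd(M,N)=1} φ(M/Q) φ(N/Q) M^{-1-ξ} N^{-1-η} (these sums converge absolutely). Then there exists a constant C' such that for all real Q ≥ 2: |S_Q(ξ,η) + S_Q(η,ξ) − φ(1/Q)² − ζ(1+ξ)ζ(1+η)/ζ(2+ξ+η)| ≤ C' Q^{-1/3}, where ζ is the Riemann zeta function. -/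
open Complex MeasureTheory Real

/-- The `n`-th summand of the expansion `(w - 1) ζ(w) = 1 + ∑ zetaTerm n w`, valid for `0 < Re w`. -/
noncomputable def zetaTerm (n : ℕ) (w : ℂ) : ℂ :=
  (w - 1) * ((n + 1 : ℝ) : ℂ) ^ (-w) +
    (((n + 2 : ℝ) : ℂ) ^ (1 - w) - ((n + 1 : ℝ) : ℂ) ^ (1 - w))

lemma differentiable_zetaTerm (n : ℕ) : Differentiable ℂ (zetaTerm n) := by
  have h1 : ((n + 1 : ℝ) : ℂ) ≠ 0 := by exact_mod_cast (by positivity : (n + 1 : ℝ) ≠ 0)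
  have h2 : ((n + 2 : ℝ) : ℂ) ≠ 0 := by exact_mod_cast (by positivity : (n + 2 : ℝ) ≠ 0)
  unfold zetaTerm
  intro w
  have e1 : DifferentiableAt ℂ (fun w : ℂ => ((n + 1 : ℝ) : ℂ) ^ (-w)) w :=
    (differentiableAt_id.neg).const_cpow (Or.inl h1)
  have e2 : DifferentiableAt ℂ (fun w : ℂ => ((n + 1 : ℝ) : ℂ) ^ (1 - w)) w :=
    (differentiableAt_id.const_sub 1).const_cpow (Or.inl h1)
  have e3 : DifferentiableAt ℂ (fun w : ℂ => ((n + 2 : ℝ) : ℂ) ^ (1 - w)) w :=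
    (differentiableAt_id.const_sub 1).const_cpow (Or.inl h2)
  fun_prop

lemma hasDerivAt_ofReal_cpow_pos {x : ℝ} (hx : 0 < x) (r : ℂ) :
    HasDerivAt (fun y : ℝ => (y : ℂ) ^ r) (r * (x : ℂ) ^ (r - 1)) x := by
  simpa using ((hasDerivAt_id (x : ℂ)).cpow_const (c := r)
    (Or.inl (by simpa using hx))).comp_ofReal

lemma norm_cpow_neg_sub_le {a x : ℝ} (ha : 0 < a) (hx : x ∈ Set.Icc a (a + 1)) {w : ℂ}
    (hw : 0 < w.re) : ‖(x : ℂ) ^ (-w) - (a : ℂ) ^ (-w)‖ ≤ ‖w‖ * a ^ (-w.re - 1) := by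
  have h := norm_image_sub_le_of_norm_deriv_le_segment' (a := a) (b := a + 1)
    (f := fun y : ℝ => (y : ℂ) ^ (-w)) (f' := fun y : ℝ => -w * (y : ℂ) ^ (-w - 1))
    (C := ‖w‖ * a ^ (-w.re - 1))
    (fun y hy => (hasDerivAt_ofReal_cpow_pos (ha.trans_le hy.1) _).hasDerivWithinAt) ?_ x hx
  · refine h.trans ?_
    have : 0 ≤ ‖w‖ * a ^ (-w.re - 1) := by positivity
    nlinarith [hx.2]
  · intro y hy
    have hy0 : 0 < y := ha.trans_le hy.1
    rw [norm_mul, norm_neg, norm_cpow_eq_rpow_re_of_pos hy0]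
    simp only [sub_re, neg_re, one_re]
    exact mul_le_mul_of_nonneg_left
      (Real.rpow_le_rpow_of_nonpos ha hy.1 (by linarith)) (norm_nonneg _)

lemma norm_zetaTerm_le (n : ℕ) {w : ℂ} (hw : 0 < w.re) :
    ‖zetaTerm n w‖ ≤ ‖w - 1‖ * ‖w‖ * (n + 1 : ℝ) ^ (-w.re - 1) := by
  set a : ℝ := n + 1 with ha_def
  have ha : 0 < a := by positivity
  have h := norm_image_sub_le_of_norm_deriv_le_segment' (a := a) (b := a + 1)
    (f := fun y : ℝ => (y : ℂ) ^ (1 - w) + (w - 1) * (a : ℂ) ^ (-w) * y)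
    (f' := fun y : ℝ => (1 - w) * (y : ℂ) ^ (1 - w - 1) + (w - 1) * (a : ℂ) ^ (-w) * 1)
    (C := ‖w - 1‖ * ‖w‖ * a ^ (-w.re - 1))
    (fun y hy => ((hasDerivAt_ofReal_cpow_pos (ha.trans_le hy.1) _).add
      ((hasDerivAt_id (y : ℂ)).comp_ofReal.const_mul _)).hasDerivWithinAt) ?_ (a + 1)
      (Set.right_mem_Icc.2 (by linarith))
  · convert h using 1
    · congr 1
      rw [zetaTerm, ← ha_def, show (n + 2 : ℝ) = a + 1 by rw [ha_def]; ring]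
      push_cast
      ring
    · ring
  · intro y hy
    have := norm_cpow_neg_sub_le ha ⟨hy.1, hy.2.le⟩ hw
    rw [show (1 - w) * (y : ℂ) ^ (1 - w - 1) + (w - 1) * (a : ℂ) ^ (-w) * 1
      = -((w - 1) * ((y : ℂ) ^ (-w) - (a : ℂ) ^ (-w))) by
        rw [show 1 - w - 1 = -w by ring]; ring, norm_neg, norm_mul, mul_assoc]
    exact mul_le_mul_of_nonneg_left this (norm_nonneg _)

lemma summable_nat_add_one_rpow {p : ℝ} (hp : p < -1) :
    Summable fun n : ℕ => (n + 1 : ℝ) ^ p := by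
  simpa using (summable_nat_add_iff 1).2 (Real.summable_nat_rpow.2 hp)

lemma tsum_zetaTerm_of_one_lt_re {w : ℂ} (hw : 1 < w.re) :
    riemannZeta₁ w = 1 + ∑' n, zetaTerm n w := by
  have hw1 : w ≠ 1 := by rintro rfl; simp at hw
  have hs : Summable fun n : ℕ => ((n + 1 : ℝ) : ℂ) ^ (-w) := by
    refine Summable.of_norm ?_
    refine (summable_nat_add_one_rpow (p := -w.re) (by linarith)).congr fun n => ?_
    rw [norm_cpow_eq_rpow_re_of_pos (by positivity), neg_re]
  have ht : HasSum (fun n : ℕ => ((n + 2 : ℝ) : ℂ) ^ (1 - w) - ((n + 1 : ℝ) : ℂ) ^ (1 - w))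
      (0 - 1) := by
    have hsum : Summable fun n : ℕ =>
        ((n + 2 : ℝ) : ℂ) ^ (1 - w) - ((n + 1 : ℝ) : ℂ) ^ (1 - w) := by
      have h1 : Summable (zetaTerm · w) := Summable.of_norm_bounded
        ((summable_nat_add_one_rpow (p := -w.re - 1) (by linarith)).mul_left _)
        fun n => norm_zetaTerm_le n (by linarith)
      refine (h1.sub (hs.mul_left (w - 1))).congr fun n => ?_
      rw [zetaTerm]; ring
    rw [hsum.hasSum_iff_tendsto_nat]
    have key : ∀ N : ℕ, ∑ n ∈ Finset.range N,
        (((n + 2 : ℝ) : ℂ) ^ (1 - w) - ((n + 1 : ℝ) : ℂ) ^ (1 - w))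
          = ((N + 1 : ℝ) : ℂ) ^ (1 - w) - 1 := by
      intro N
      have := Finset.sum_range_sub (fun n : ℕ => ((n + 1 : ℝ) : ℂ) ^ (1 - w)) N
      simp only [Nat.cast_add, Nat.cast_one, Nat.cast_zero, zero_add, ofReal_one, one_cpow] at this
      rw [← this]
      refine Finset.sum_congr rfl fun n _ => ?_
      norm_num [add_assoc]
    simp_rw [key]
    refine Filter.Tendsto.sub_const ?_ 1
    rw [tendsto_zero_iff_norm_tendsto_zero]
    have : Filter.Tendsto (fun N : ℕ => (N + 1 : ℝ) ^ (-(w.re - 1))) Filter.atTop (nhds 0) :=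
      (tendsto_rpow_neg_atTop (by linarith)).comp
        (Filter.tendsto_atTop_add_const_right _ 1 tendsto_natCast_atTop_atTop)
    refine this.congr fun N => ?_
    rw [norm_cpow_eq_rpow_re_of_pos (by positivity)]
    simp
  have h := (hs.hasSum.mul_left (w - 1)).add ht
  have hz : riemannZeta w = ∑' n : ℕ, ((n + 1 : ℝ) : ℂ) ^ (-w) := by
    rw [zeta_eq_tsum_one_div_nat_add_one_cpow hw]
    refine tsum_congr fun n => ?_
    rw [cpow_neg, one_div]; push_cast; rfl
  have e : ∑' n, zetaTerm n w = _ := h.tsum_eq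
  rw [e, ← hz, riemannZeta_eq_inv_sub_mul hw1]
  have := sub_ne_zero.2 hw1
  field_simp
  ring

lemma riemannZeta₁_eq_tsum {w : ℂ} (hw : 0 < w.re) :
    riemannZeta₁ w = 1 + ∑' n, zetaTerm n w := by
  set U : Set ℂ := {z | w.re / 2 < z.re} ∩ Metric.ball 0 (‖w‖ + 3) with hU
  have hUo : IsOpen U := (isOpen_lt continuous_const continuous_re).inter Metric.isOpen_ball
  have hUc : IsPreconnected U :=
    ((convex_halfSpace_re_gt _).inter (convex_ball _ _)).isPreconnected
  have hwU : w ∈ U := ⟨by simp; linarith, by simp⟩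
  have hd : DifferentiableOn ℂ (fun z => 1 + ∑' n, zetaTerm n z) U := by
    refine (differentiableOn_const _).add ?_
    refine differentiableOn_tsum_of_summable_norm
      (u := fun n : ℕ => (‖w‖ + 4) * (‖w‖ + 3) * (n + 1 : ℝ) ^ (-(w.re / 2) - 1))
      ((summable_nat_add_one_rpow (by linarith)).mul_left _)
      (fun n => (differentiable_zetaTerm n).differentiableOn) hUo ?_
    intro n z hz
    have h1 : w.re / 2 < z.re := hz.1
    have h2 : ‖z‖ < ‖w‖ + 3 := by simpa using hz.2
    refine (norm_zetaTerm_le n (by linarith)).trans ?_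
    have h3 : ‖z - 1‖ ≤ ‖w‖ + 4 := (norm_sub_le _ _).trans (by rw [norm_one]; linarith)
    have h4 : (n + 1 : ℝ) ^ (-z.re - 1) ≤ (n + 1 : ℝ) ^ (-(w.re / 2) - 1) :=
      Real.rpow_le_rpow_of_exponent_le (by simp) (by linarith)
    gcongr
  set z₀ : ℂ := ((max w.re 2 : ℝ) : ℂ) with hz₀
  have hz₀U : z₀ ∈ U := by
    refine ⟨?_, ?_⟩
    · simp [hz₀]; left; linarith
    · simp only [hz₀, Metric.mem_ball, dist_zero_right, norm_real, Real.norm_eq_abs]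
      rw [abs_of_nonneg (by positivity)]
      have := re_le_norm w
      have := norm_nonneg w
      exact max_lt (by linarith) (by linarith)
  refine ((differentiable_riemannZeta₁.differentiableOn.analyticOnNhd hUo).eqOn_of_preconnected_of_eventuallyEq
    (hd.analyticOnNhd hUo) hUc hz₀U ?_) hwU
  have : {z : ℂ | 1 < z.re} ∈ nhds z₀ :=
    (isOpen_lt continuous_const continuous_re).mem_nhds (by simp [hz₀])
  filter_upwards [this] with z hz using tsum_zetaTerm_of_one_lt_re hz

/-- Linear growth of `ζ` in vertical strips, phrased for the entire function `(w - 1) ζ(w)`. -/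
lemma exists_norm_riemannZeta₁_le {δ : ℝ} (hδ : 0 < δ) :
    ∃ K, 0 ≤ K ∧ ∀ w : ℂ, δ ≤ w.re → ‖riemannZeta₁ w‖ ≤ 1 + K * (‖w - 1‖ * ‖w‖) := by
  have hsum := summable_nat_add_one_rpow (p := -δ - 1) (by linarith)
  refine ⟨∑' n : ℕ, (n + 1 : ℝ) ^ (-δ - 1), tsum_nonneg fun n => by positivity, fun w hw => ?_⟩
  rw [riemannZeta₁_eq_tsum (hδ.trans_le hw)]
  refine (norm_add_le _ _).trans ?_
  rw [norm_one, mul_comm _ (‖w - 1‖ * ‖w‖)]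
  gcongr
  refine tsum_of_norm_bounded (hsum.hasSum.mul_left _) fun n => ?_
  refine (norm_zetaTerm_le n (hδ.trans_le hw)).trans ?_
  gcongr
  · simp

lemma intervalIntegral_inv_add_mul_I {c : ℝ} (hc : c ≠ 0) (T : ℝ) :
    ∫ t in (-T)..T, ((c : ℂ) + t * I)⁻¹ = ((2 * Real.arctan (T / c) : ℝ) : ℂ) := by
  have hne : ∀ t : ℝ, (c : ℂ) + t * I ≠ 0 := fun t h => hc (by simpa using congrArg re h)
  have hpos : ∀ t : ℝ, c ^ 2 + t ^ 2 ≠ 0 := fun t => by positivity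
  have hderiv : ∀ t : ℝ, HasDerivAt
      (fun t : ℝ => ((Real.arctan (t / c) : ℝ) : ℂ) - I / 2 * ((Real.log (c ^ 2 + t ^ 2) : ℝ) : ℂ))
      ((c : ℂ) + t * I)⁻¹ t := by
    intro t
    have h1 := (((hasDerivAt_id t).div_const c).arctan).ofReal_comp
    have h2 := ((((hasDerivAt_id t).pow 2).const_add (c ^ 2)).log (hpos t)).ofReal_comp
    refine (h1.sub (h2.const_mul (I / 2))).congr_deriv ?_
    have e1 : (c : ℂ) ≠ 0 := by exact_mod_cast hc
    have e2 : (c : ℂ) ^ 2 + (t : ℂ) ^ 2 ≠ 0 := by exact_mod_cast hpos t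
    have e3 : ((c : ℂ) + t * I) * (c - t * I) = c ^ 2 + t ^ 2 := by
      ring_nf; rw [I_sq]; ring
    refine eq_inv_of_mul_eq_one_left ?_
    simp only [id, Pi.pow_apply]
    push_cast
    have e4 : (1 : ℂ) + ((t : ℂ) / c) ^ 2 = (c ^ 2 + t ^ 2) / c ^ 2 := by field_simp
    rw [e4]
    field_simp
    linear_combination e3
  have hcont : Continuous fun t : ℝ => ((c : ℂ) + t * I)⁻¹ :=
    (by fun_prop : Continuous fun t : ℝ => (c : ℂ) + t * I).inv₀ hne
  rw [intervalIntegral.integral_eq_sub_of_hasDerivAt (fun t _ => hderiv t)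
    (hcont.intervalIntegrable _ _)]
  rw [neg_div, Real.arctan_neg, neg_sq]
  push_cast
  ring

open Filter Topology in
/-- Moving a vertical line of integration past a simple pole at the origin. -/
lemma integral_div_sub_integral_div_eq {u : ℂ → ℂ} {a b K : ℝ} (ha : a < 0) (hb : 0 < b)
    (hu : DifferentiableOn ℂ u {s : ℂ | a ≤ s.re ∧ s.re ≤ b})
    (hK : ∀ s : ℂ, a ≤ s.re → s.re ≤ b → ‖u s‖ ≤ K)
    (hia : Integrable fun t : ℝ => u (a + t * I) / (a + t * I))
    (hib : Integrable fun t : ℝ => u (b + t * I) / (b + t * I)) :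
    (∫ t : ℝ, u (b + t * I) / (b + t * I)) - ∫ t : ℝ, u (a + t * I) / (a + t * I)
      = 2 * π * u 0 := by
  set V : Set ℂ := {s : ℂ | a ≤ s.re ∧ s.re ≤ b} with hV
  have hV0 : V ∈ 𝓝 (0 : ℂ) := by
    have : {s : ℂ | a < s.re} ∩ {s : ℂ | s.re < b} ∈ 𝓝 (0 : ℂ) :=
      ((isOpen_lt continuous_const continuous_re).inter
        (isOpen_lt continuous_re continuous_const)).mem_nhds ⟨by simpa, by simpa⟩
    exact mem_of_superset this fun s hs => ⟨le_of_lt hs.1, le_of_lt hs.2⟩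
  have hD : DifferentiableOn ℂ (dslope u 0) V :=
    (Complex.differentiableOn_dslope hV0).2 hu
  have hDne : ∀ s : ℂ, s ≠ 0 → dslope u 0 s = u s / s - u 0 * s⁻¹ := by
    intro s hs
    rw [dslope_of_ne _ hs, slope_def_field, sub_zero]
    field_simp
  have hne : ∀ c : ℝ, c ≠ 0 → ∀ t : ℝ, (c : ℂ) + t * I ≠ 0 :=
    fun c hc t h => hc (by simpa using congrArg re h)
  have hmem : ∀ c : ℝ, a ≤ c → c ≤ b → ∀ t : ℝ, (c : ℂ) + t * I ∈ V := by
    intro c h1 h2 t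
    simp [hV, h1, h2]
  have hvert : ∀ c : ℝ, c ≠ 0 → a ≤ c → c ≤ b →
      Integrable (fun t : ℝ => u (c + t * I) / (c + t * I)) → ∀ T : ℝ,
      ∫ t in (-T)..T, dslope u 0 (c + t * I) =
        (∫ t in (-T)..T, u (c + t * I) / (c + t * I)) -
          u 0 * ((2 * Real.arctan (T / c) : ℝ) : ℂ) := by
    intro c hc h1 h2 hi T
    rw [← intervalIntegral_inv_add_mul_I hc T, ← intervalIntegral.integral_const_mul,
      ← intervalIntegral.integral_sub hi.intervalIntegrable]
    · refine intervalIntegral.integral_congr fun t _ => ?_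
      exact hDne _ (hne c hc t)
    · have : Continuous fun t : ℝ => u 0 * ((c : ℂ) + t * I)⁻¹ :=
        continuous_const.mul
          ((by fun_prop : Continuous fun t : ℝ => (c : ℂ) + t * I).inv₀ (hne c hc))
      exact this.intervalIntegrable _ _
  have hhor : ∀ f : ℝ → ℝ, (∀ T, |f T| = |T|) →
      Tendsto (fun T : ℝ => ∫ x in a..b, dslope u 0 (x + (f T : ℝ) * I)) atTop (𝓝 0) := by
    intro f hf
    have hlim : Tendsto (fun T : ℝ => (2 * K) * T⁻¹ * |b - a|) atTop (𝓝 0) := by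
      simpa using (tendsto_inv_atTop_zero.const_mul (2 * K)).mul_const |b - a|
    refine squeeze_zero_norm' ?_ hlim
    filter_upwards [eventually_gt_atTop 0] with T hT
    refine intervalIntegral.norm_integral_le_of_norm_le_const fun x hx => ?_
    rw [Set.uIoc_of_le (by linarith)] at hx
    have hfT : f T ≠ 0 := by
      intro h
      have := hf T
      rw [h, abs_zero, abs_of_pos hT] at this
      linarith
    have hnz : (x : ℂ) + (f T : ℝ) * I ≠ 0 := fun h => hfT (by simpa using congrArg im h)
    have hlow : T ≤ ‖(x : ℂ) + (f T : ℝ) * I‖ := by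
      have := abs_im_le_norm ((x : ℂ) + (f T : ℝ) * I)
      simp only [add_im, ofReal_im, mul_im, ofReal_re, I_im, I_re, mul_one, mul_zero, add_zero,
        zero_add, hf T, abs_of_pos hT] at this
      exact this
    have hm := hmem x hx.1.le hx.2 (f T)
    rw [dslope_of_ne _ hnz, slope_def_field, sub_zero, norm_div, div_eq_mul_inv]
    have h0 : ‖u 0‖ ≤ K := hK 0 (by simpa using ha.le) (by simpa using hb.le)
    have h1 : ‖u (x + (f T : ℝ) * I)‖ ≤ K := hK _ hm.1 hm.2
    have h2 := norm_sub_le (u (x + (f T : ℝ) * I)) (u 0)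
    have : ‖u (x + (f T : ℝ) * I) - u 0‖ ≤ 2 * K := by linarith
    gcongr
    exact (norm_nonneg _).trans this
  have hrect : ∀ T : ℝ,
      (∫ t in (-T)..T, u (b + t * I) / (b + t * I)) - (∫ t in (-T)..T, u (a + t * I) / (a + t * I))
      = u 0 * ((2 * Real.arctan (T / b) : ℝ) : ℂ) - u 0 * ((2 * Real.arctan (T / a) : ℝ) : ℂ)
        + I * ((∫ x in a..b, dslope u 0 (x + ((-T : ℝ) : ℂ) * I))
          - ∫ x in a..b, dslope u 0 (x + (T : ℂ) * I)) := by
    intro T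
    have h := Complex.integral_boundary_rect_eq_zero_of_differentiableOn (dslope u 0)
      ⟨a, -T⟩ ⟨b, T⟩ (hD.mono ?_)
    · simp only [smul_eq_mul] at h
      rw [hvert b hb.ne' (by linarith) le_rfl hib, hvert a ha.ne le_rfl (by linarith) hia] at h
      generalize ((2 * Real.arctan (T / b) : ℝ) : ℂ) = α at h ⊢
      generalize ((2 * Real.arctan (T / a) : ℝ) : ℂ) = β at h ⊢
      linear_combination (-I) * h +
        ((∫ t in (-T)..T, u (b + t * I) / (b + t * I)) -
          (∫ t in (-T)..T, u (a + t * I) / (a + t * I)) - u 0 * α + u 0 * β) * I_sq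
    · intro s hs
      have := hs.1
      rw [Set.mem_preimage, Set.uIcc_of_le (by simp; linarith)] at this
      exact this
  have hl1 : Tendsto (fun T : ℝ => ((2 * Real.arctan (T / b) : ℝ) : ℂ)) atTop (𝓝 (π : ℂ)) := by
    have : Tendsto (fun T : ℝ => 2 * Real.arctan (T / b)) atTop (𝓝 π) := by
      have := ((Real.tendsto_arctan_atTop.mono_right nhdsWithin_le_nhds).comp
        (tendsto_id.atTop_div_const hb)).const_mul 2
      rwa [show 2 * (π / 2) = π by ring] at this
    exact (continuous_ofReal.tendsto _).comp this
  have hl2 : Tendsto (fun T : ℝ => ((2 * Real.arctan (T / a) : ℝ) : ℂ)) atTop (𝓝 (-π : ℂ)) := by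
    have : Tendsto (fun T : ℝ => 2 * Real.arctan (T / a)) atTop (𝓝 (-π)) := by
      have := ((Real.tendsto_arctan_atBot.mono_right nhdsWithin_le_nhds).comp
        (tendsto_id.atTop_div_const_of_neg ha)).const_mul 2
      rwa [show 2 * (-(π / 2)) = -π by ring] at this
    rw [← ofReal_neg]
    exact (continuous_ofReal.tendsto _).comp this
  have hR := ((hl1.const_mul (u 0)).sub (hl2.const_mul (u 0))).add
    (((hhor (fun T => -T) (fun T => abs_neg T)).sub (hhor (fun T => T) (fun T => rfl))).const_mul I)
  have hL := (intervalIntegral_tendsto_integral hib tendsto_neg_atTop_atBot tendsto_id).sub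
    (intervalIntegral_tendsto_integral hia tendsto_neg_atTop_atBot tendsto_id)
  have := tendsto_nhds_unique (hL.congr hrect) hR
  rw [this]
  ring

lemma one_add_sq_le_of_third_le_abs {c : ℝ} (hc : 1 / 3 ≤ |c|) (t : ℝ) :
    1 + t ^ 2 ≤ 4 * ((1 + |t|) * ‖(c : ℂ) + t * I‖) := by
  have h1 : |c| ≤ ‖(c : ℂ) + t * I‖ := by simpa using abs_re_le_norm ((c : ℂ) + t * I)
  have h2 : |t| ≤ ‖(c : ℂ) + t * I‖ := by simpa using abs_im_le_norm ((c : ℂ) + t * I)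
  have h3 : 1 + |t| ≤ 4 * ‖(c : ℂ) + t * I‖ := by
    linarith
  have h4 := abs_nonneg t
  rw [← sq_abs t]
  nlinarith

/-- The Mellin-type integral `∫ h(c + it) X^(c + it) / (c + it) dt`, shifted from `c = 1` to
`c = -1/3`. -/
lemma exists_norm_integral_sub_le {h : ℂ → ℂ} {K : ℝ}
    (hd : DifferentiableOn ℂ h {s : ℂ | -(1 / 3 : ℝ) ≤ s.re ∧ s.re ≤ 1})
    (hK : ∀ s : ℂ, -(1 / 3 : ℝ) ≤ s.re → s.re ≤ 1 → ‖h s‖ ≤ K / (1 + |s.im|))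
    {X : ℝ} (hX : 0 < X) :
    ‖(∫ t : ℝ, h (1 + t * I) * (X : ℂ) ^ (1 + t * I) / (1 + t * I)) - 2 * π * h 0‖
      ≤ 4 * K * π * X ^ (-(1 / 3) : ℝ) := by
  have hK0 : 0 ≤ K := by
    have := (norm_nonneg _).trans (hK 0 (by norm_num) (by norm_num))
    simpa using this
  set u : ℂ → ℂ := fun s => h s * (X : ℂ) ^ s with hu_def
  have hX0 : (X : ℂ) ≠ 0 := by exact_mod_cast hX.ne'
  have hu : DifferentiableOn ℂ u {s : ℂ | -(1 / 3 : ℝ) ≤ s.re ∧ s.re ≤ 1} :=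
    hd.mul fun s _ => (differentiableAt_id.const_cpow (Or.inl hX0)).differentiableWithinAt
  have hbd : ∀ s : ℂ, -(1 / 3 : ℝ) ≤ s.re → s.re ≤ 1 → ‖u s‖ ≤ K / (1 + |s.im|) * X ^ s.re := by
    intro s h1 h2
    rw [hu_def, norm_mul, norm_cpow_eq_rpow_re_of_pos hX]
    exact mul_le_mul_of_nonneg_right (hK s h1 h2) (by positivity)
  have hline : ∀ c : ℝ, 1 / 3 ≤ |c| → -(1 / 3 : ℝ) ≤ c → c ≤ 1 → ∀ t : ℝ,
      ‖u (c + t * I) / (c + t * I)‖ ≤ 4 * K * X ^ c * (1 + t ^ 2)⁻¹ := by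
    intro c hc h1 h2 t
    have hb := hbd (c + t * I) (by simpa using h1) (by simpa using h2)
    have hq := one_add_sq_le_of_third_le_abs hc t
    simp only [add_re, ofReal_re, mul_re, I_re, mul_zero, ofReal_im, I_im, mul_one, sub_self,
      add_zero, add_im, mul_im, zero_add] at hb
    have hn : 0 < ‖(c : ℂ) + t * I‖ := by
      by_contra hcon
      have := norm_nonneg ((c : ℂ) + t * I)
      have h0 : ‖(c : ℂ) + t * I‖ = 0 := by linarith
      rw [h0] at hq
      nlinarith [sq_nonneg t]
    have ht : 0 < 1 + |t| := by positivity
    rw [norm_div, div_le_iff₀ hn]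
    refine hb.trans ?_
    have hXc : 0 ≤ X ^ c := by positivity
    rw [div_mul_eq_mul_div, div_le_iff₀ ht]
    have : 4 * K * X ^ c * (1 + t ^ 2)⁻¹ * ‖(c : ℂ) + t * I‖ * (1 + |t|)
      = K * X ^ c * (4 * ((1 + |t|) * ‖(c : ℂ) + t * I‖) / (1 + t ^ 2)) := by
        rw [div_eq_mul_inv]; ring
    rw [this]
    refine le_mul_of_one_le_right (by positivity) ?_
    rwa [one_le_div (by positivity)]
  have hint : ∀ c : ℝ, 1 / 3 ≤ |c| → -(1 / 3 : ℝ) ≤ c → c ≤ 1 →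
      Integrable fun t : ℝ => u (c + t * I) / (c + t * I) := by
    intro c hc h1 h2
    refine (integrable_inv_one_add_sq.const_mul (4 * K * X ^ c)).mono' ?_
      (Filter.Eventually.of_forall (hline c hc h1 h2))
    refine Continuous.aestronglyMeasurable (Continuous.div ?_ (by fun_prop) ?_)
    · exact hu.continuousOn.comp_continuous (by fun_prop) fun t => ⟨by simpa using h1, by simpa using h2⟩
    · intro t h0
      have : c = 0 := by simpa using congrArg re h0
      rw [this, abs_zero] at hc
      norm_num at hc
  have h13 : (1 / 3 : ℝ) ≤ |-(1 / 3 : ℝ)| := by norm_num [abs_of_pos]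
  have h11 : (1 / 3 : ℝ) ≤ |(1 : ℝ)| := by norm_num
  have hia := hint (-(1 / 3)) h13 le_rfl (by norm_num)
  have hib := hint 1 h11 (by norm_num) le_rfl
  have hshift := integral_div_sub_integral_div_eq (u := u) (a := -(1 / 3)) (b := 1)
    (K := K * (X ^ (1 : ℝ) + X ^ (-(1 / 3) : ℝ))) (by norm_num) (by norm_num) hu ?_ hia hib
  · have hu0 : u 0 = h 0 := by simp [hu_def]
    rw [hu0] at hshift
    rw [ofReal_one] at hshift
    rw [← hshift, hu_def, sub_sub_cancel]
    refine (norm_integral_le_of_norm_le (integrable_inv_one_add_sq.const_mul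
      (4 * K * X ^ (-(1 / 3) : ℝ)))
      (Filter.Eventually.of_forall (hline (-(1 / 3)) h13 le_rfl (by norm_num)))).trans ?_
    rw [integral_const_mul, integral_univ_inv_one_add_sq]
    exact le_of_eq (by ring)
  · intro s h1 h2
    refine (hbd s h1 h2).trans ?_
    have : K / (1 + |s.im|) ≤ K := div_le_self hK0 (by linarith [abs_nonneg s.im])
    refine mul_le_mul this ?_ (by positivity) hK0
    rcases le_total 1 X with hX1 | hX1
    · exact (Real.rpow_le_rpow_of_exponent_le hX1 h2).trans
        (le_add_of_nonneg_right (by positivity))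
    · exact (Real.rpow_le_rpow_of_exponent_ge hX hX1 h1).trans
        (le_add_of_nonneg_left (by positivity))

/-- The Mellin transform datum of the theorem: holomorphic on the strip up to a simple pole with
residue `1` at the origin, with cubic decay. -/
structure IsStripTransform (ψ : ℂ → ℂ) (g : ℂ → ℂ) (C : ℝ) : Prop where
  differentiableOn : DifferentiableOn ℂ g {s : ℂ | -(1 / 2) ≤ s.re ∧ s.re ≤ 2}
  eq_add : ∀ s ∈ {s : ℂ | -(1 / 2) ≤ s.re ∧ s.re ≤ 2}, s ≠ 0 → ψ s = g s + 1 / s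
  decay : ∀ s ∈ {s : ℂ | -(1 / 2) ≤ s.re ∧ s.re ≤ 2}, 1 ≤ |s.im| →
      ‖ψ s‖ ≤ C / (1 + |s.im|) ^ 3

/-- The holomorphic function `s ψ(s) (w - 1) ζ(w) / (s + ξ)`, `w = 1 + ξ + s`, when
`ψ s = g s + 1 / s` vanishes at `-ξ`. -/
noncomputable def mellinNumerator (g : ℂ → ℂ) (ξ s : ℂ) : ℂ :=
  dslope (fun s => s * g s + 1) (-ξ) s * riemannZeta₁ (1 + ξ + s)

namespace IsStripTransform

variable {ψ g : ℂ → ℂ} {C : ℝ} {ξ : ℂ}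

lemma mul_eq (H : IsStripTransform ψ g C) {s : ℂ} (hs : -(1 / 2) ≤ s.re ∧ s.re ≤ 2) (h0 : s ≠ 0) :
    s * g s + 1 = s * ψ s := by
  rw [H.eq_add s hs h0]; field_simp

lemma dslope_eq (H : IsStripTransform ψ g C) (hξ : ξ ≠ 0) (hre : |ξ.re| ≤ 1 / 10)
    (hz : ψ (-ξ) = 0) {s : ℂ} (hsξ : s ≠ -ξ) :
    dslope (fun s => s * g s + 1) (-ξ) s = (s * g s + 1) / (s + ξ) := by
  obtain ⟨h1, h2⟩ := abs_le.1 hre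
  have hm : -ξ * g (-ξ) + 1 = 0 := by
    rw [H.mul_eq (by constructor <;> simp <;> linarith) (neg_ne_zero.2 hξ), hz, mul_zero]
  rw [dslope_of_ne _ hsξ, slope_def_field, hm, sub_zero, sub_neg_eq_add]

lemma differentiableOn_mellinNumerator (H : IsStripTransform ψ g C) (hre : |ξ.re| ≤ 1 / 10) :
    DifferentiableOn ℂ (mellinNumerator g ξ) {s : ℂ | -(1 / 2) ≤ s.re ∧ s.re ≤ 2} := by
  obtain ⟨h1, h2⟩ := abs_le.1 hre
  refine DifferentiableOn.mul ((Complex.differentiableOn_dslope ?_).2 ?_) ?_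
  · have : {s : ℂ | -(1 / 2) < s.re} ∩ {s : ℂ | s.re < 2} ∈ nhds (-ξ) :=
      ((isOpen_lt continuous_const continuous_re).inter
        (isOpen_lt continuous_re continuous_const)).mem_nhds
        ⟨by simp; linarith, by simp; linarith⟩
    exact Filter.mem_of_superset this fun s hs => ⟨le_of_lt hs.1, le_of_lt hs.2⟩
  · exact (differentiableOn_id.mul H.differentiableOn).add_const _
  · exact (differentiable_riemannZeta₁.comp (by fun_prop)).differentiableOn

lemma mellinNumerator_zero (H : IsStripTransform ψ g C) (hξ : ξ ≠ 0) (hre : |ξ.re| ≤ 1 / 10)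
    (hz : ψ (-ξ) = 0) : mellinNumerator g ξ 0 = riemannZeta (1 + ξ) := by
  rw [mellinNumerator, H.dslope_eq hξ hre hz (by simpa [eq_comm] using hξ),
    riemannZeta_eq_inv_sub_mul (by simpa using hξ)]
  simp

lemma mellinNumerator_div (H : IsStripTransform ψ g C) (hξ : ξ ≠ 0) (hre : |ξ.re| ≤ 1 / 10)
    (hz : ψ (-ξ) = 0) {s : ℂ} (hs : -(1 / 2) ≤ s.re ∧ s.re ≤ 2) (h0 : s ≠ 0) (hsξ : s ≠ -ξ) :
    mellinNumerator g ξ s / s = ψ s * riemannZeta (1 + ξ + s) := by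
  have h : s + ξ ≠ 0 := fun h => hsξ (eq_neg_of_add_eq_zero_left h)
  have h' : 1 + ξ + s ≠ 1 := fun h' => h (by linear_combination h')
  rw [mellinNumerator, H.dslope_eq hξ hre hz hsξ, riemannZeta_eq_inv_sub_mul h', H.mul_eq hs h0,
    show 1 + ξ + s - 1 = s + ξ by ring]
  field_simp

lemma nonneg (H : IsStripTransform ψ g C) : 0 ≤ C := by
  have := (norm_nonneg _).trans (H.decay I (by norm_num) (by simp))
  by_contra hC
  have : C / (1 + |I.im|) ^ 3 < 0 := div_neg_of_neg_of_pos (by linarith) (by positivity)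
  linarith

lemma exists_norm_mellinNumerator_le (H : IsStripTransform ψ g C) (hξ : ξ ≠ 0)
    (hre : |ξ.re| ≤ 1 / 10) (hz : ψ (-ξ) = 0) :
    ∃ K, ∀ s : ℂ, -(1 / 3 : ℝ) ≤ s.re → s.re ≤ 1 →
      ‖mellinNumerator g ξ s‖ ≤ K / (1 + |s.im|) := by
  obtain ⟨h1, h2⟩ := abs_le.1 hre
  obtain ⟨Z, hZ0, hZ⟩ := exists_norm_riemannZeta₁_le (δ := 1 / 2) (by norm_num)
  set T : ℝ := 2 * (1 + ‖ξ‖) with hT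
  have hcomp : IsCompact (Set.Icc (-(1 / 3 : ℝ)) 1 ×ℂ Set.Icc (-T) T) :=
    isCompact_Icc.reProdIm isCompact_Icc
  have hcont : ContinuousOn (mellinNumerator g ξ) (Set.Icc (-(1 / 3 : ℝ)) 1 ×ℂ Set.Icc (-T) T) := by
    refine (H.differentiableOn_mellinNumerator hre).continuousOn.mono fun s hs => ?_
    have := hs.1
    simp only [Set.mem_preimage, Set.mem_Icc] at this
    exact ⟨by linarith, by linarith⟩
  obtain ⟨M, hM⟩ := hcomp.exists_bound_of_continuousOn hcont
  have hC := H.nonneg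
  set K₁ := M * (1 + T)
  set K₂ := 2 * C * (1 + Z * (2 + ‖ξ‖) ^ 2)
  refine ⟨max K₁ K₂, fun s hs1 hs2 => ?_⟩
  have hpos : 0 < 1 + |s.im| := by positivity
  rw [le_div_iff₀ hpos]
  rcases le_total |s.im| T with ht | ht
  · refine le_trans ?_ (le_max_left _ _)
    have hMs := hM s ⟨⟨hs1, hs2⟩, abs_le.1 ht⟩
    have hM0 := (norm_nonneg _).trans hMs
    exact mul_le_mul hMs (by linarith) hpos.le hM0
  · refine le_trans ?_ (le_max_right _ _)
    have hξn := norm_nonneg ξ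
    have him : |s.im| ≤ ‖s‖ := abs_im_le_norm s
    have hs0 : s ≠ 0 := by
      rintro rfl; simp at him; simp at ht; linarith
    have hhalf : ‖s‖ / 2 ≤ ‖s + ξ‖ := by
      have := norm_sub_le (s + ξ) ξ
      rw [add_sub_cancel_right] at this
      linarith
    have hspos : 0 < ‖s‖ := norm_pos_iff.2 hs0
    have hsξ : s ≠ -ξ := by
      rintro rfl
      rw [neg_add_cancel, norm_zero] at hhalf
      linarith
    have hstrip : -(1 / 2) ≤ s.re ∧ s.re ≤ 2 := ⟨by linarith, by linarith⟩
    have hdec := H.decay s hstrip (by linarith)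
    have hq : ‖dslope (fun s => s * g s + 1) (-ξ) s‖ ≤ 2 * (C / (1 + |s.im|) ^ 3) := by
      rw [H.dslope_eq hξ hre hz hsξ, H.mul_eq hstrip hs0, norm_div, norm_mul,
        div_le_iff₀ (by linarith)]
      have : 0 ≤ C / (1 + |s.im|) ^ 3 := by positivity
      nlinarith [norm_nonneg (ψ s)]
    have hsle : ‖s‖ ≤ 1 + |s.im| := by
      refine (norm_le_abs_re_add_abs_im s).trans ?_
      have : |s.re| ≤ 1 := abs_le.2 ⟨by linarith, hs2⟩
      linarith
    have hzeta : ‖riemannZeta₁ (1 + ξ + s)‖ ≤ (1 + Z * (2 + ‖ξ‖) ^ 2) * (1 + |s.im|) ^ 2 := by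
      refine (hZ _ (by simp; linarith)).trans ?_
      have e1 : ‖1 + ξ + s‖ ≤ (2 + ‖ξ‖) * (1 + |s.im|) := by
        refine (norm_add₃_le).trans ?_
        rw [norm_one]
        nlinarith [abs_nonneg s.im]
      have e2 : ‖1 + ξ + s - 1‖ ≤ (2 + ‖ξ‖) * (1 + |s.im|) := by
        rw [show 1 + ξ + s - 1 = ξ + s by ring]
        refine (norm_add_le _ _).trans ?_
        nlinarith [abs_nonneg s.im]
      have e3 : ‖1 + ξ + s - 1‖ * ‖1 + ξ + s‖ ≤ ((2 + ‖ξ‖) * (1 + |s.im|)) ^ 2 := by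
        rw [sq]; gcongr
      have e4 : 1 ≤ (1 + |s.im|) ^ 2 := by nlinarith [abs_nonneg s.im]
      nlinarith [mul_le_mul_of_nonneg_left e3 hZ0]
    rw [mellinNumerator, norm_mul]
    have hfin : ‖dslope (fun s => s * g s + 1) (-ξ) s‖ * ‖riemannZeta₁ (1 + ξ + s)‖ ≤
        2 * (C / (1 + |s.im|) ^ 3) * ((1 + Z * (2 + ‖ξ‖) ^ 2) * (1 + |s.im|) ^ 2) := by
      gcongr
    refine (mul_le_mul_of_nonneg_right hfin hpos.le).trans (le_of_eq ?_)
    simp only [K₂]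
    field_simp

lemma exists_norm_integral_zeta_sub_le (H : IsStripTransform ψ g C) (hξ : ξ ≠ 0)
    (hre : |ξ.re| ≤ 1 / 10) (hz : ψ (-ξ) = 0) :
    ∃ K, ∀ X : ℝ, 0 < X →
      ‖(∫ t : ℝ, ψ (1 + I * t) * (X : ℂ) ^ (1 + I * t) * riemannZeta (2 + ξ + I * t))
        - 2 * π * riemannZeta (1 + ξ)‖ ≤ K * X ^ (-(1 / 3) : ℝ) := by
  obtain ⟨h1, h2⟩ := abs_le.1 hre
  obtain ⟨K, hK⟩ := H.exists_norm_mellinNumerator_le hξ hre hz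
  refine ⟨4 * K * π, fun X hX => ?_⟩
  have := exists_norm_integral_sub_le
    ((H.differentiableOn_mellinNumerator hre).mono fun s hs =>
      ⟨by linarith [hs.1], by linarith [hs.2]⟩) hK hX
  rw [H.mellinNumerator_zero hξ hre hz] at this
  convert this using 5 with t
  have hs0 : (1 : ℂ) + t * I ≠ 0 := fun h => by simpa using congrArg re h
  have hsξ : (1 : ℂ) + t * I ≠ -ξ := fun h => by
    have := congrArg re h
    simp at this
    linarith
  rw [mul_div_right_comm, H.mellinNumerator_div hξ hre hz (by norm_num) hs0 hsξ, mul_comm I]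
  rw [show 1 + ξ + (1 + t * I) = 2 + ξ + t * I by ring]
  ring

lemma continuous_line (H : IsStripTransform ψ g C) : Continuous fun t : ℝ => ψ (1 + I * t) := by
  have hs0 : ∀ t : ℝ, (1 : ℂ) + I * t ≠ 0 := fun t h => by simpa using congrArg re h
  have hmem : ∀ t : ℝ, (1 : ℂ) + I * t ∈ {s : ℂ | -(1 / 2) ≤ s.re ∧ s.re ≤ 2} := by
    intro t; norm_num
  have h : (fun t : ℝ => ψ (1 + I * t)) = fun t : ℝ => g (1 + I * t) + 1 / (1 + I * t) := by
    funext t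
    exact H.eq_add _ (hmem t) (hs0 t)
  rw [h]
  refine (H.differentiableOn.continuousOn.comp_continuous (by fun_prop) hmem).add ?_
  exact continuous_const.div (by fun_prop) hs0

lemma exists_norm_line_le (H : IsStripTransform ψ g C) :
    ∃ P, 0 ≤ P ∧ ∀ t : ℝ, ‖ψ (1 + I * t)‖ ≤ P * (1 + t ^ 2)⁻¹ := by
  obtain ⟨M, hM⟩ := (isCompact_Icc (a := (-1 : ℝ)) (b := 1)).exists_bound_of_continuousOn
    H.continuous_line.continuousOn
  have hM0 : 0 ≤ M := (norm_nonneg _).trans (hM 0 (by norm_num))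
  have hC := H.nonneg
  refine ⟨2 * M + C, by positivity, fun t => ?_⟩
  rw [← div_eq_mul_inv, le_div_iff₀ (by positivity), ← sq_abs t]
  rcases le_total |t| 1 with ht | ht
  · have := hM t (abs_le.1 ht)
    have : |t| ^ 2 ≤ 1 := by nlinarith [abs_nonneg t]
    nlinarith [norm_nonneg (ψ (1 + I * t))]
  · have := H.decay (1 + I * t) (by norm_num) (by simpa using ht)
    have him : (1 + I * t : ℂ).im = t := by simp
    rw [him] at this
    have h3 : C / (1 + |t|) ^ 3 * (1 + |t| ^ 2) ≤ C := by
      rw [div_mul_eq_mul_div, div_le_iff₀ (by positivity)]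
      refine mul_le_mul_of_nonneg_left ?_ hC
      nlinarith [pow_nonneg (abs_nonneg t) 3]
    nlinarith [mul_le_mul_of_nonneg_right this (by positivity : 0 ≤ 1 + |t| ^ 2)]

end IsStripTransform

/-- The inverse Mellin transform along `Re s = 1`. -/
noncomputable def lineTransform (ψ : ℂ → ℂ) (y : ℝ) : ℂ :=
  (1 / (2 * π)) * ∫ t : ℝ, ψ (1 + I * t) * (y : ℂ) ^ (-(1 : ℂ) - I * t)

/-- The smoothed Dirichlet series `∑ φ(m / X) m^(-1 - ξ)`, with `φ` the inverse Mellin transform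
of `ψ`. -/
noncomputable def smoothedZeta (ψ : ℂ → ℂ) (ξ : ℂ) (X : ℝ) : ℂ :=
  ∑' m : ℕ, lineTransform ψ (m / X) * (m : ℂ) ^ (-1 - ξ)

namespace IsStripTransform

variable {ψ g : ℂ → ℂ} {C : ℝ} {ξ : ℂ}

lemma exists_norm_lineTransform_le (H : IsStripTransform ψ g C) :
    ∃ B, 0 ≤ B ∧ ∀ y : ℝ, 0 < y → ‖lineTransform ψ y‖ ≤ B * y⁻¹ := by
  obtain ⟨P, hP0, hP⟩ := H.exists_norm_line_le
  refine ⟨‖(1 / (2 * π) : ℂ)‖ * (P * π), by positivity, fun y hy => ?_⟩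
  rw [lineTransform, norm_mul, mul_assoc]
  refine mul_le_mul_of_nonneg_left ?_ (norm_nonneg _)
  refine (norm_integral_le_of_norm_le (integrable_inv_one_add_sq.const_mul (P * y⁻¹))
    (Filter.Eventually.of_forall fun t => ?_)).trans ?_
  · rw [norm_mul, norm_cpow_eq_rpow_re_of_pos hy]
    have : (-(1 : ℂ) - I * t).re = -1 := by simp
    rw [this, Real.rpow_neg_one]
    have := mul_le_mul_of_nonneg_right (hP t) (by positivity : 0 ≤ y⁻¹)
    linarith
  · rw [integral_const_mul, integral_univ_inv_one_add_sq]
    exact le_of_eq (by ring)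

lemma smoothedZeta_eq (H : IsStripTransform ψ g C) (hre : |ξ.re| ≤ 1 / 10) {X : ℝ} (hX : 0 < X) :
    smoothedZeta ψ ξ X = (1 / (2 * π)) *
      ∫ t : ℝ, ψ (1 + I * t) * (X : ℂ) ^ (1 + I * t) * riemannZeta (2 + ξ + I * t) := by
  obtain ⟨h1, h2⟩ := abs_le.1 hre
  obtain ⟨P, hP0, hP⟩ := H.exists_norm_line_le
  have hX0 : (X : ℂ) ≠ 0 := by exact_mod_cast hX.ne'
  set F : ℕ → ℝ → ℂ := fun m t =>
    ψ (1 + I * t) * (X : ℂ) ^ (1 + I * t) * (1 / (m : ℂ) ^ (2 + ξ + I * t)) with hF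
  have hne : ∀ t : ℝ, (2 + ξ + I * t).re ≠ 0 := fun t => by simp; linarith
  have hne' : ∀ t : ℝ, (2 + ξ + I * t) ≠ 0 := fun t h => hne t (by rw [h, zero_re])
  have hFb : ∀ m t, ‖F m t‖ ≤ P * X * (m : ℝ) ^ (-(2 + ξ.re)) * (1 + t ^ 2)⁻¹ := by
    intro m t
    rw [hF, norm_mul, norm_mul, norm_cpow_eq_rpow_re_of_pos hX, norm_div, norm_one,
      norm_natCast_cpow_of_re_ne_zero _ (hne t), Real.rpow_neg (Nat.cast_nonneg m), one_div]
    have e1 : (1 + I * t : ℂ).re = 1 := by simp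
    have e2 : (2 + ξ + I * t : ℂ).re = 2 + ξ.re := by simp
    rw [e1, e2, Real.rpow_one]
    have := mul_le_mul_of_nonneg_right (hP t)
      (by positivity : 0 ≤ X * ((m : ℝ) ^ (2 + ξ.re))⁻¹)
    linarith
  have hFcont : ∀ m, Continuous (F m) := by
    intro m
    rcases Nat.eq_zero_or_pos m with rfl | hm
    · have : F 0 = fun _ => 0 := by
        funext t; simp [hF, zero_cpow (hne' t)]
      rw [this]; exact continuous_const
    · have hm0 : (m : ℂ) ≠ 0 := by exact_mod_cast hm.ne'
      refine (H.continuous_line.mul ?_).mul (continuous_const.div ?_ ?_)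
      · exact Continuous.const_cpow (by fun_prop) (Or.inl hX0)
      · exact Continuous.const_cpow (by fun_prop) (Or.inl hm0)
      · intro t; simp [cpow_eq_zero_iff, hm0]
  have hFi : ∀ m, Integrable (F m) := fun m =>
    (integrable_inv_one_add_sq.const_mul _).mono' (hFcont m).aestronglyMeasurable
      (Filter.Eventually.of_forall (hFb m))
  have hFs : Summable fun m => ∫ t, ‖F m t‖ := by
    refine Summable.of_nonneg_of_le (fun m => integral_nonneg fun t => norm_nonneg _)
      (fun m => ?_) ((Real.summable_nat_rpow (p := -(2 + ξ.re))).2 (by linarith) |>.mul_left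
        (P * X * π))
    refine (integral_mono (hFi m).norm (integrable_inv_one_add_sq.const_mul _) (hFb m)).trans ?_
    rw [integral_const_mul, integral_univ_inv_one_add_sq]
    exact le_of_eq (by ring)
  have hsum := hasSum_integral_of_summable_integral_norm hFi hFs
  have hz : ∀ t : ℝ, ∑' m, F m t =
      ψ (1 + I * t) * (X : ℂ) ^ (1 + I * t) * riemannZeta (2 + ξ + I * t) := by
    intro t
    rw [hF, tsum_mul_left, zeta_eq_tsum_one_div_nat_cpow (by simp; linarith)]
  simp_rw [hz] at hsum
  rw [← (hsum.mul_left _).tsum_eq, smoothedZeta]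
  refine tsum_congr fun m => ?_
  rcases Nat.eq_zero_or_pos m with rfl | hm
  · have e1 : (-1 - ξ : ℂ) ≠ 0 := fun h => by
      have := congrArg re h
      simp at this
      linarith
    simp [hF, zero_cpow (hne' _), zero_cpow e1]
  · have hm0 : (m : ℂ) ≠ 0 := by exact_mod_cast hm.ne'
    rw [lineTransform, mul_assoc, ← integral_mul_const]
    congr 1
    refine integral_congr_ae (Filter.Eventually.of_forall fun t => ?_)
    simp only [hF]
    rw [mul_assoc, mul_assoc]
    congr 1
    have hdiv : ((m / X : ℝ) : ℂ) ^ (-(1 : ℂ) - I * t)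
        = (m : ℂ) ^ (-(1 : ℂ) - I * t) * (X : ℂ) ^ (1 + I * t) := by
      rw [div_eq_mul_inv, ofReal_mul, mul_cpow_ofReal_nonneg (by positivity) (by positivity),
        ofReal_inv, inv_cpow _ _ (by rw [arg_ofReal_of_nonneg hX.le]; exact Real.pi_ne_zero.symm),
        ← cpow_neg, ofReal_natCast]
      congr 2
      ring
    rw [hdiv, one_div, ← cpow_neg, mul_right_comm, ← cpow_add _ _ hm0, mul_comm]
    congr 2
    ring

lemma exists_norm_smoothedZeta_sub_le (H : IsStripTransform ψ g C) (hξ : ξ ≠ 0)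
    (hre : |ξ.re| ≤ 1 / 10) (hz : ψ (-ξ) = 0) :
    ∃ K, ∀ X : ℝ, 0 < X →
      ‖smoothedZeta ψ ξ X - riemannZeta (1 + ξ)‖ ≤ K * X ^ (-(1 / 3) : ℝ) := by
  obtain ⟨K, hK⟩ := H.exists_norm_integral_zeta_sub_le hξ hre hz
  refine ⟨‖(1 / (2 * π) : ℂ)‖ * K, fun X hX => ?_⟩
  have hpi : (π : ℂ) ≠ 0 := by exact_mod_cast Real.pi_ne_zero
  have hone : riemannZeta (1 + ξ) = 1 / (2 * π) * (2 * π * riemannZeta (1 + ξ)) := by field_simp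
  rw [H.smoothedZeta_eq hre hX, mul_assoc, hone, ← mul_sub, norm_mul]
  exact mul_le_mul_of_nonneg_left (hK X hX) (norm_nonneg _)

lemma exists_norm_lineTransform_mul_cpow_le (H : IsStripTransform ψ g C) :
    ∃ B, 0 ≤ B ∧ ∀ ξ : ℂ, |ξ.re| ≤ 1 / 10 → ∀ X : ℝ, 0 < X → ∀ m : ℕ,
      ‖lineTransform ψ (m / X) * (m : ℂ) ^ (-1 - ξ)‖ ≤ B * X * (m : ℝ) ^ (-(19 / 10) : ℝ) := by
  obtain ⟨B, hB0, hB⟩ := H.exists_norm_lineTransform_le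
  refine ⟨B, hB0, fun ξ hre X hX m => ?_⟩
  obtain ⟨h1, h2⟩ := abs_le.1 hre
  have hre0 : (-1 - ξ).re ≠ 0 := by simp; linarith
  rw [norm_mul, norm_natCast_cpow_of_re_ne_zero _ hre0]
  rcases Nat.eq_zero_or_pos m with rfl | hm
  · rw [Nat.cast_zero, Real.zero_rpow hre0, mul_zero]
    positivity
  · have hm' : (0 : ℝ) < m := by exact_mod_cast hm
    have hm1 : (1 : ℝ) ≤ m := by exact_mod_cast hm
    have e1 := hB (m / X) (by positivity)
    have e2 : (m : ℝ) ^ (-1 - ξ).re ≤ (m : ℝ) ^ (-(9 / 10) : ℝ) :=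
      Real.rpow_le_rpow_of_exponent_le hm1 (by simp; linarith)
    refine (mul_le_mul e1 e2 (by positivity) (by positivity)).trans (le_of_eq ?_)
    rw [show (-(19 / 10) : ℝ) = -1 + -(9 / 10) by norm_num, Real.rpow_add hm', Real.rpow_neg_one,
      inv_div]
    ring

lemma exists_norm_smoothedZeta_le (H : IsStripTransform ψ g C) (hξ : ξ ≠ 0)
    (hre : |ξ.re| ≤ 1 / 10) (hz : ψ (-ξ) = 0) :
    ∃ K, ∀ X : ℝ, 0 < X → ‖smoothedZeta ψ ξ X‖ ≤ K := by
  obtain ⟨K, hK⟩ := H.exists_norm_smoothedZeta_sub_le hξ hre hz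
  obtain ⟨B, hB0, hB⟩ := H.exists_norm_lineTransform_mul_cpow_le
  have hs : Summable fun m : ℕ => (m : ℝ) ^ (-(19 / 10) : ℝ) :=
    Real.summable_nat_rpow.2 (by norm_num)
  have hK0 : 0 ≤ K := by simpa using (norm_nonneg _).trans (hK 1 one_pos)
  refine ⟨max (K + ‖riemannZeta (1 + ξ)‖) (B * ∑' m : ℕ, (m : ℝ) ^ (-(19 / 10) : ℝ)),
    fun X hX => ?_⟩
  rcases le_total 1 X with h | h
  · refine le_trans ?_ (le_max_left _ _)
    have e1 := hK X hX
    have e2 : X ^ (-(1 / 3) : ℝ) ≤ 1 := Real.rpow_le_one_of_one_le_of_nonpos h (by norm_num)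
    have e3 := norm_le_norm_sub_add (smoothedZeta ψ ξ X) (riemannZeta (1 + ξ))
    nlinarith
  · refine le_trans ?_ (le_max_right _ _)
    refine tsum_of_norm_bounded (hs.hasSum.mul_left B) fun m => (hB ξ hre X hX m).trans ?_
    have : B * X ≤ B := mul_le_of_le_one_right hB0 h
    gcongr

end IsStripTransform

section Moebius

open ArithmeticFunction

lemma sum_divisors_moebius (n : ℕ) :
    ∑ d ∈ n.divisors, (moebius d : ℂ) = if n = 1 then 1 else 0 := by
  have h := congrArg (fun f : ArithmeticFunction ℤ => f n) moebius_mul_coe_zeta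
  simp only [coe_mul_zeta_apply, one_apply] at h
  exact_mod_cast h

lemma rpow_mul_rpow_le_of_dvd {d m n : ℕ} (hm : m ≠ 0) (hn : n ≠ 0) (hdm : d ∣ m) (hdn : d ∣ n) :
    (m : ℝ) ^ (-(19 / 10) : ℝ) * (n : ℝ) ^ (-(19 / 10) : ℝ) ≤
      (d : ℝ) ^ (-(12 / 10) : ℝ) * ((m : ℝ) ^ (-(13 / 10) : ℝ) * (n : ℝ) ^ (-(13 / 10) : ℝ)) := by
  have hd : 0 < d := Nat.pos_of_dvd_of_pos hdm (Nat.pos_of_ne_zero hm)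
  have hd' : (0 : ℝ) < d := by exact_mod_cast hd
  have key : ∀ k : ℕ, k ≠ 0 → d ∣ k →
      (k : ℝ) ^ (-(19 / 10) : ℝ) ≤ (d : ℝ) ^ (-(6 / 10) : ℝ) * (k : ℝ) ^ (-(13 / 10) : ℝ) := by
    intro k hk hdk
    have hk' : (0 : ℝ) < k := by exact_mod_cast Nat.pos_of_ne_zero hk
    have hle : (d : ℝ) ≤ k := by exact_mod_cast Nat.le_of_dvd (Nat.pos_of_ne_zero hk) hdk
    rw [show (-(19 / 10) : ℝ) = -(6 / 10) + -(13 / 10) by norm_num, Real.rpow_add hk']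
    exact mul_le_mul_of_nonneg_right
      (Real.rpow_le_rpow_of_nonpos hd' hle (by norm_num)) (by positivity)
  refine (mul_le_mul (key m hm hdm) (key n hn hdn) (by positivity) (by positivity)).trans
    (le_of_eq ?_)
  rw [show (-(12 / 10) : ℝ) = -(6 / 10) + -(6 / 10) by norm_num, Real.rpow_add hd']
  ring

variable {a b : ℕ → ℂ} {A B : ℝ}

lemma summable_norm_of_le_rpow (ha : ∀ m : ℕ, ‖a m‖ ≤ A * (m : ℝ) ^ (-(19 / 10) : ℝ)) :
    Summable fun m => ‖a m‖ :=
  Summable.of_nonneg_of_le (fun _ => norm_nonneg _) ha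
    ((Real.summable_nat_rpow.2 (by norm_num)).mul_left A)

/-- Detecting coprimality by the Möbius function. -/
lemma tsum_coprime_eq (hA : 0 ≤ A) (hB : 0 ≤ B)
    (ha : ∀ m : ℕ, ‖a m‖ ≤ A * (m : ℝ) ^ (-(19 / 10) : ℝ))
    (hb : ∀ m : ℕ, ‖b m‖ ≤ B * (m : ℝ) ^ (-(19 / 10) : ℝ)) :
    ∑' p : ℕ × ℕ, (if Nat.Coprime p.1 p.2 then a p.1 * b p.2 else 0) =
      ∑' d : ℕ, (moebius d : ℂ) * ((∑' m, a (d * m)) * ∑' n, b (d * n)) := by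
  have ha0 : a 0 = 0 := by
    have := ha 0
    rw [Nat.cast_zero, Real.zero_rpow (by norm_num), mul_zero] at this
    simpa using this
  have hb0 : b 0 = 0 := by
    have := hb 0
    rw [Nat.cast_zero, Real.zero_rpow (by norm_num), mul_zero] at this
    simpa using this
  set f : ℕ → ℕ × ℕ → ℂ := fun d p =>
    if d ∣ p.1 ∧ d ∣ p.2 then (moebius d : ℂ) * (a p.1 * b p.2) else 0 with hf
  have hpt : ∀ p : ℕ × ℕ, (if Nat.Coprime p.1 p.2 then a p.1 * b p.2 else 0) = ∑' d, f d p := by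
    rintro ⟨m, n⟩
    rcases eq_or_ne m 0 with rfl | hm
    · simp [hf, ha0]
    rcases eq_or_ne n 0 with rfl | hn
    · simp [hf, hb0]
    have hg : m.gcd n ≠ 0 := fun h => hm (Nat.eq_zero_of_gcd_eq_zero_left h)
    rw [tsum_eq_sum (s := (m.gcd n).divisors)]
    · have : ∀ d ∈ (m.gcd n).divisors, f d (m, n) = (moebius d : ℂ) * (a m * b n) := by
        intro d hd
        have := Nat.dvd_gcd_iff.1 (Nat.dvd_of_mem_divisors hd)
        simp [hf, this]
      rw [Finset.sum_congr rfl this, ← Finset.sum_mul, sum_divisors_moebius]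
      simp [Nat.Coprime]
    · intro d hd
      have : ¬ (d ∣ m ∧ d ∣ n) := fun h => hd (Nat.mem_divisors.2 ⟨Nat.dvd_gcd h.1 h.2, hg⟩)
      simp [hf, this]
  have hsum : Summable (Function.uncurry fun (p : ℕ × ℕ) (d : ℕ) => f d p) := by
    have h13 : Summable fun m : ℕ => (m : ℝ) ^ (-(13 / 10) : ℝ) :=
      Real.summable_nat_rpow.2 (by norm_num)
    have h12 : Summable fun m : ℕ => (m : ℝ) ^ (-(12 / 10) : ℝ) :=
      Real.summable_nat_rpow.2 (by norm_num)
    have hnn : ∀ q : ℝ, 0 ≤ fun m : ℕ => (m : ℝ) ^ q := fun q m => by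
      simp only [Pi.zero_apply]; positivity
    have h := (((h13.mul_of_nonneg h13 (hnn _) (hnn _)).mul_of_nonneg h12
      (fun p => by simp only [Pi.zero_apply]; positivity) (hnn _)).mul_left (A * B))
    refine Summable.of_norm_bounded h ?_
    rintro ⟨⟨m, n⟩, d⟩
    simp only [Function.uncurry, hf]
    split_ifs with hd
    swap
    · rw [norm_zero]; positivity
    rcases eq_or_ne m 0 with rfl | hm
    · rw [ha0, zero_mul, mul_zero, norm_zero]; positivity
    rcases eq_or_ne n 0 with rfl | hn
    · rw [hb0, mul_zero, mul_zero, norm_zero]; positivity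
    have hmu : ‖(moebius d : ℂ)‖ ≤ 1 := by
      rw [norm_intCast]; exact_mod_cast abs_moebius_le_one
    rw [norm_mul, norm_mul]
    calc ‖(moebius d : ℂ)‖ * (‖a m‖ * ‖b n‖)
        ≤ 1 * ((A * (m : ℝ) ^ (-(19 / 10) : ℝ)) * (B * (n : ℝ) ^ (-(19 / 10) : ℝ))) := by
          gcongr
          · exact ha m
          · exact hb n
      _ = A * B * ((m : ℝ) ^ (-(19 / 10) : ℝ) * (n : ℝ) ^ (-(19 / 10) : ℝ)) := by ring
      _ ≤ A * B * ((d : ℝ) ^ (-(12 / 10) : ℝ) *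
            ((m : ℝ) ^ (-(13 / 10) : ℝ) * (n : ℝ) ^ (-(13 / 10) : ℝ))) := by
          exact mul_le_mul_of_nonneg_left (rpow_mul_rpow_le_of_dvd hm hn hd.1 hd.2) (by positivity)
      _ = _ := by ring
  simp_rw [hpt]
  rw [← hsum.tsum_comm]
  refine tsum_congr fun d => ?_
  rcases Nat.eq_zero_or_pos d with rfl | hd
  · simp [hf]
  have hinj : Function.Injective fun p : ℕ × ℕ => (d * p.1, d * p.2) := by
    rintro ⟨m, n⟩ ⟨m', n'⟩ h
    simp only [Prod.mk.injEq] at h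
    rw [Nat.eq_of_mul_eq_mul_left hd h.1, Nat.eq_of_mul_eq_mul_left hd h.2]
  have hsupp : Function.support (f d) ⊆ Set.range fun p : ℕ × ℕ => (d * p.1, d * p.2) := by
    rintro ⟨m, n⟩ hp
    by_cases h : d ∣ m ∧ d ∣ n
    · obtain ⟨⟨m', rfl⟩, n', rfl⟩ := h
      exact ⟨(m', n'), rfl⟩
    · exact absurd (by simp [hf, h]) hp
  have hinj1 : Function.Injective fun m : ℕ => d * m := fun m n h =>
    Nat.eq_of_mul_eq_mul_left hd h
  rw [← hinj.tsum_eq hsupp, tsum_mul_tsum_of_summable_norm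
    ((summable_norm_of_le_rpow ha).comp_injective hinj1)
    ((summable_norm_of_le_rpow hb).comp_injective hinj1), ← tsum_mul_left]
  refine tsum_congr fun p => ?_
  simp [hf]

lemma norm_term_moebius_le (s : ℂ) (d : ℕ) :
    ‖LSeries.term (fun n => (moebius n : ℂ)) s d‖ ≤ (d : ℝ) ^ (-s.re) := by
  rcases Nat.eq_zero_or_pos d with rfl | hd
  · simp only [LSeries.term_zero, norm_zero]; positivity
  · have hmu : ‖(moebius d : ℂ)‖ ≤ 1 := by
      rw [norm_intCast]; exact_mod_cast abs_moebius_le_one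
    rw [LSeries.term_of_ne_zero hd.ne', norm_div, norm_natCast_cpow_of_pos hd,
      Real.rpow_neg (Nat.cast_nonneg d), div_eq_mul_inv]
    exact mul_le_of_le_one_left (by positivity) hmu

lemma tsum_term_moebius {s : ℂ} (hs : 1 < s.re) :
    ∑' d, LSeries.term (fun n => (moebius n : ℂ)) s d = 1 / riemannZeta s := by
  have h := LSeries_one_mul_Lseries_moebius hs
  rw [LSeries_one_eq_riemannZeta hs] at h
  exact eq_one_div_of_mul_eq_one_right h

end Moebius

/-- Splitting a sum over coprime pairs according to which entry is larger. -/
lemma tsum_coprime_le_add_tsum_coprime_ge {a b : ℕ → ℂ} (ha : Summable fun m => ‖a m‖)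
    (hb : Summable fun m => ‖b m‖) (ha0 : a 0 = 0) (hb0 : b 0 = 0) :
    (∑' p : ℕ × ℕ, if 1 ≤ p.1 ∧ p.1 ≤ p.2 ∧ Nat.Coprime p.1 p.2 then a p.1 * b p.2 else 0) +
      (∑' p : ℕ × ℕ, if 1 ≤ p.1 ∧ p.1 ≤ p.2 ∧ Nat.Coprime p.1 p.2 then b p.1 * a p.2 else 0) -
      a 1 * b 1 = ∑' p : ℕ × ℕ, if Nat.Coprime p.1 p.2 then a p.1 * b p.2 else 0 := by
  have hab : Summable fun p : ℕ × ℕ => ‖a p.1 * b p.2‖ := by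
    refine (ha.mul_norm hb).congr fun p => ?_
    simp
  have hind : ∀ (P : ℕ × ℕ → Prop) [DecidablePred P],
      Summable fun p : ℕ × ℕ => if P p then a p.1 * b p.2 else 0 := by
    intro P _
    refine Summable.of_norm_bounded hab fun p => ?_
    split_ifs
    · exact le_rfl
    · rw [norm_zero]
      exact norm_nonneg _
  have hswap : (∑' p : ℕ × ℕ, if 1 ≤ p.1 ∧ p.1 ≤ p.2 ∧ Nat.Coprime p.1 p.2
      then b p.1 * a p.2 else 0) =
      ∑' p : ℕ × ℕ, if 1 ≤ p.2 ∧ p.2 ≤ p.1 ∧ Nat.Coprime p.1 p.2 then a p.1 * b p.2 else 0 := by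
    rw [← (Equiv.prodComm ℕ ℕ).tsum_eq]
    refine tsum_congr fun p => ?_
    simp only [Equiv.prodComm_apply, Prod.fst_swap, Prod.snd_swap, Nat.coprime_comm (n := p.1),
      mul_comm (b p.2)]
  have hone : a 1 * b 1 = ∑' p : ℕ × ℕ, if p = (1, 1) then a p.1 * b p.2 else 0 := by
    rw [tsum_eq_single (1, 1) (fun p hp => if_neg hp)]
    simp
  rw [hswap, hone, ← (hind _).tsum_add (hind _), ← ((hind _).add (hind _)).tsum_sub (hind _)]
  refine tsum_congr fun ⟨m, n⟩ => ?_
  rcases Nat.eq_zero_or_pos m with rfl | hm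
  · simp [ha0]
  rcases Nat.eq_zero_or_pos n with rfl | hn
  · simp [hb0]
  by_cases hc : Nat.Coprime m n
  · rcases lt_trichotomy m n with h | rfl | h
    · have h1 : ¬ n ≤ m := by omega
      have h2 : (m, n) ≠ (1, 1) := by simp only [ne_eq, Prod.mk.injEq]; omega
      rw [if_pos ⟨hm, h.le, hc⟩, if_neg (fun h' => h1 h'.2.1), if_neg h2, if_pos hc]
      ring
    · rw [Nat.coprime_self] at hc
      subst hc
      simp
    · have h1 : ¬ m ≤ n := by omega
      have h2 : (m, n) ≠ (1, 1) := by simp only [ne_eq, Prod.mk.injEq]; omega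
      rw [if_neg (fun h' => h1 h'.2.1), if_pos ⟨hn, h.le, hc⟩, if_neg h2, if_pos hc]
      ring
  · have h2 : ¬ (m = 1 ∧ n = 1) := by rintro ⟨rfl, rfl⟩; simp at hc
    simp [hc, h2]

namespace IsStripTransform

variable {ψ g : ℂ → ℂ} {C : ℝ} {ξ η : ℂ}

lemma tsum_dilate_eq {Q : ℝ} (ψ : ℂ → ℂ) (ξ : ℂ) {d : ℕ} (hd : d ≠ 0) :
    ∑' m : ℕ, lineTransform ψ ((d * m : ℕ) / Q) * ((d * m : ℕ) : ℂ) ^ (-1 - ξ) =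
      (d : ℂ) ^ (-1 - ξ) * smoothedZeta ψ ξ (Q / d) := by
  have hd' : (d : ℝ) ≠ 0 := by exact_mod_cast hd
  rw [smoothedZeta, ← tsum_mul_left]
  refine tsum_congr fun m => ?_
  have : ((d * m : ℕ) : ℝ) / Q = m / (Q / d) := by
    rw [div_div_eq_mul_div]; push_cast; ring
  rw [this, Nat.cast_mul, natCast_mul_natCast_cpow]
  ring

lemma exists_norm_tsum_coprime_sub_le (H : IsStripTransform ψ g C) (hξ : ξ ≠ 0) (hη : η ≠ 0)
    (hξre : |ξ.re| ≤ 1 / 10) (hηre : |η.re| ≤ 1 / 10) (hzξ : ψ (-ξ) = 0) (hzη : ψ (-η) = 0) :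
    ∃ K, ∀ Q : ℝ, 0 < Q →
      ‖(∑' p : ℕ × ℕ, if Nat.Coprime p.1 p.2 then
          (lineTransform ψ (p.1 / Q) * (p.1 : ℂ) ^ (-1 - ξ)) *
            (lineTransform ψ (p.2 / Q) * (p.2 : ℂ) ^ (-1 - η)) else 0) -
        riemannZeta (1 + ξ) * riemannZeta (1 + η) / riemannZeta (2 + ξ + η)‖
        ≤ K * Q ^ (-(1 / 3) : ℝ) := by
  obtain ⟨B, hB0, hB⟩ := H.exists_norm_lineTransform_mul_cpow_le
  obtain ⟨K₁, hK₁⟩ := H.exists_norm_smoothedZeta_sub_le hξ hξre hzξ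
  obtain ⟨K₂, hK₂⟩ := H.exists_norm_smoothedZeta_sub_le hη hηre hzη
  obtain ⟨M₁, hM₁⟩ := H.exists_norm_smoothedZeta_le hξ hξre hzξ
  obtain ⟨M₂, hM₂⟩ := H.exists_norm_smoothedZeta_le hη hηre hzη
  obtain ⟨h1, h2⟩ := abs_le.1 hξre
  obtain ⟨h3, h4⟩ := abs_le.1 hηre
  set z₁ := riemannZeta (1 + ξ)
  set z₂ := riemannZeta (1 + η)
  have hsre : (2 + ξ + η).re = 2 + ξ.re + η.re := by simp
  set c : ℕ → ℂ := LSeries.term (fun n => (ArithmeticFunction.moebius n : ℂ)) (2 + ξ + η) with hc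
  have hcb : ∀ d : ℕ, ‖c d‖ ≤ (d : ℝ) ^ (-(2 + ξ + η).re) := norm_term_moebius_le _
  have hcs : Summable c := Summable.of_norm_bounded (Real.summable_nat_rpow.2 (by linarith)) hcb
  set L : ℝ := K₁ * M₂ + ‖z₁‖ * K₂ with hL
  have hs : Summable fun d : ℕ => (d : ℝ) ^ (-(2 + ξ + η).re + 1 / 3) :=
    Real.summable_nat_rpow.2 (by linarith)
  refine ⟨L * ∑' d : ℕ, (d : ℝ) ^ (-(2 + ξ + η).re + 1 / 3), fun Q hQ => ?_⟩
  have hterm : ∀ d : ℕ, d ≠ 0 → c d = (ArithmeticFunction.moebius d : ℂ) *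
      ((d : ℂ) ^ (-1 - ξ) * (d : ℂ) ^ (-1 - η)) := by
    intro d hd
    have hd' : (d : ℂ) ≠ 0 := by exact_mod_cast hd
    rw [hc, LSeries.term_of_ne_zero hd, div_eq_mul_inv, ← cpow_neg, ← cpow_add _ _ hd']
    congr 2
    ring
  have hT := tsum_coprime_eq (by positivity) (by positivity) (hB ξ hξre Q hQ) (hB η hηre Q hQ)
  rw [hT]
  have hrew : ∀ d : ℕ, (ArithmeticFunction.moebius d : ℂ) *
      ((∑' m : ℕ, lineTransform ψ ((d * m : ℕ) / Q) * ((d * m : ℕ) : ℂ) ^ (-1 - ξ)) *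
        ∑' n : ℕ, lineTransform ψ ((d * n : ℕ) / Q) * ((d * n : ℕ) : ℂ) ^ (-1 - η)) =
      c d * (smoothedZeta ψ ξ (Q / d) * smoothedZeta ψ η (Q / d)) := by
    intro d
    rcases eq_or_ne d 0 with rfl | hd
    · simp [hc]
    · rw [tsum_dilate_eq ψ ξ hd, tsum_dilate_eq ψ η hd, hterm d hd]
      ring
  simp_rw [hrew]
  have hmain : z₁ * z₂ / riemannZeta (2 + ξ + η) = ∑' d, c d * (z₁ * z₂) := by
    rw [tsum_mul_right, tsum_term_moebius (by linarith)]
    ring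
  have hcQ : ∀ d : ℕ, ‖c d * (smoothedZeta ψ ξ (Q / d) * smoothedZeta ψ η (Q / d)) -
      c d * (z₁ * z₂)‖ ≤ L * Q ^ (-(1 / 3) : ℝ) * (d : ℝ) ^ (-(2 + ξ + η).re + 1 / 3) := by
    intro d
    have hM20 := (norm_nonneg _).trans (hM₂ 1 one_pos)
    have hK10 : 0 ≤ K₁ := by simpa using (norm_nonneg _).trans (hK₁ 1 one_pos)
    have hK20 : 0 ≤ K₂ := by simpa using (norm_nonneg _).trans (hK₂ 1 one_pos)
    have hL0 : 0 ≤ L := by positivity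
    rcases Nat.eq_zero_or_pos d with rfl | hd
    · have : c 0 = 0 := by simp [hc]
      rw [this, zero_mul, zero_mul, sub_zero, norm_zero]
      positivity
    have hd' : (0 : ℝ) < d := by exact_mod_cast hd
    have hX : 0 < Q / d := by positivity
    have e : smoothedZeta ψ ξ (Q / d) * smoothedZeta ψ η (Q / d) - z₁ * z₂ =
        (smoothedZeta ψ ξ (Q / d) - z₁) * smoothedZeta ψ η (Q / d) +
          z₁ * (smoothedZeta ψ η (Q / d) - z₂) := by ring
    have e' : ‖smoothedZeta ψ ξ (Q / d) * smoothedZeta ψ η (Q / d) - z₁ * z₂‖ ≤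
        L * (Q / d) ^ (-(1 / 3) : ℝ) := by
      rw [e]
      refine (norm_add_le _ _).trans ?_
      rw [norm_mul, norm_mul]
      have f1 := mul_le_mul (hK₁ _ hX) (hM₂ _ hX) (norm_nonneg _) (by positivity)
      have f2 := mul_le_mul_of_nonneg_left (hK₂ _ hX) (norm_nonneg z₁)
      rw [hL]
      linarith
    rw [← mul_sub, norm_mul]
    refine (mul_le_mul (hcb d) e' (norm_nonneg _) (by positivity)).trans (le_of_eq ?_)
    rw [Real.div_rpow hQ.le hd'.le, Real.rpow_add hd', Real.rpow_neg hd'.le (1 / 3), div_inv_eq_mul]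
    ring
  have hdiff : Summable fun d : ℕ => c d * (smoothedZeta ψ ξ (Q / d) * smoothedZeta ψ η (Q / d)) -
      c d * (z₁ * z₂) := Summable.of_norm_bounded (hs.mul_left _) hcQ
  have hfirst : Summable fun d : ℕ =>
      c d * (smoothedZeta ψ ξ (Q / d) * smoothedZeta ψ η (Q / d)) :=
    (hdiff.add (hcs.mul_right (z₁ * z₂))).congr fun d => by ring
  rw [hmain, ← hfirst.tsum_sub (hcs.mul_right _)]
  refine (tsum_of_norm_bounded (hs.hasSum.mul_left _) hcQ).trans (le_of_eq ?_)
  ring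

end IsStripTransform

/-- Let `φ̃` be holomorphic on the closed strip `-1/2 ≤ Re s ≤ 2` except
for a simple pole at `s = 0` with residue `1` (encoded: `φ̃(s) = g(s) + 1/s` with `g`
holomorphic on the strip), satisfying the decay `|φ̃(s)| ≤ C(1+|Im s|)^{-3}` for
`|Im s| ≥ 1` in the strip.  Let `ξ, η ≠ 0` with `|Re ξ|, |Re η| ≤ 1/10` and
`φ̃(-ξ) = φ̃(-η) = 0`.  With `φ(y) = (1/2π)∫_ℝ φ̃(1+it) y^{-1-it} dt` for `y > 0` and
`S_Q(ξ,η) = Σ_{1 ≤ M ≤ N, (M,N)=1} φ(M/Q) φ(N/Q) M^{-1-ξ} N^{-1-η}`, there is `C'`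
such that for all `Q ≥ 2`:
`|S_Q(ξ,η) + S_Q(η,ξ) − φ(1/Q)² − ζ(1+ξ)ζ(1+η)/ζ(2+ξ+η)| ≤ C' Q^{-1/3}`. -/
theorem stmt_0 (φt : ℂ → ℂ)
    (hφt : ∃ g : ℂ → ℂ, DifferentiableOn ℂ g {s : ℂ | -(1 / 2) ≤ s.re ∧ s.re ≤ 2} ∧
      ∀ s ∈ {s : ℂ | -(1 / 2) ≤ s.re ∧ s.re ≤ 2}, s ≠ 0 → φt s = g s + 1 / s)
    (C : ℝ)
    (hdecay : ∀ s ∈ {s : ℂ | -(1 / 2) ≤ s.re ∧ s.re ≤ 2}, 1 ≤ |s.im| →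
      ‖φt s‖ ≤ C / (1 + |s.im|) ^ 3)
    (ξ η : ℂ) (hξ : ξ ≠ 0) (hη : η ≠ 0)
    (hξre : |ξ.re| ≤ 1 / 10) (hηre : |η.re| ≤ 1 / 10)
    (hzξ : φt (-ξ) = 0) (hzη : φt (-η) = 0)
    (φ : ℝ → ℂ)
    (hφ : ∀ y : ℝ, 0 < y →
      φ y = (1 / (2 * π)) * ∫ t : ℝ, φt (1 + I * t) * (y : ℂ) ^ (-(1 : ℂ) - I * t))
    (S : ℝ → ℂ → ℂ → ℂ)
    (hS : ∀ (Q : ℝ) (ξ' η' : ℂ), S Q ξ' η' =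
      ∑' p : ℕ × ℕ, if 1 ≤ p.1 ∧ p.1 ≤ p.2 ∧ Nat.Coprime p.1 p.2 then
        φ ((p.1 : ℝ) / Q) * φ ((p.2 : ℝ) / Q) * (p.1 : ℂ) ^ (-1 - ξ') * (p.2 : ℂ) ^ (-1 - η')
      else 0) :
    ∃ C' : ℝ, ∀ Q : ℝ, 2 ≤ Q →
      ‖S Q ξ η + S Q η ξ - φ (1 / Q) ^ 2 -
        riemannZeta (1 + ξ) * riemannZeta (1 + η) / riemannZeta (2 + ξ + η)‖ ≤
        C' * Q ^ (-(1 / 3) : ℝ) := by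
  obtain ⟨g, hg, hgt⟩ := hφt
  have H : IsStripTransform φt g C := ⟨hg, hgt, hdecay⟩
  obtain ⟨K, hK⟩ := H.exists_norm_tsum_coprime_sub_le hξ hη hξre hηre hzξ hzη
  obtain ⟨B, -, hB⟩ := H.exists_norm_lineTransform_mul_cpow_le
  refine ⟨K, fun Q hQ => ?_⟩
  have hQ0 : 0 < Q := by linarith
  have hφL : ∀ y : ℝ, 0 < y → φ y = lineTransform φt y := hφ
  have hne : ∀ ζ : ℂ, |ζ.re| ≤ 1 / 10 → (-1 - ζ) ≠ 0 := by
    intro ζ hζ h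
    have h' := congrArg re h
    simp at h'
    linarith [(abs_le.1 hζ).1]
  have hS' : ∀ α β : ℂ, S Q α β = ∑' p : ℕ × ℕ,
      if 1 ≤ p.1 ∧ p.1 ≤ p.2 ∧ Nat.Coprime p.1 p.2 then
        (lineTransform φt (p.1 / Q) * (p.1 : ℂ) ^ (-1 - α)) *
          (lineTransform φt (p.2 / Q) * (p.2 : ℂ) ^ (-1 - β)) else 0 := by
    intro α β
    rw [hS]
    refine tsum_congr fun p => ?_
    split_ifs with hp
    · have h1 : (0 : ℝ) < p.1 := by exact_mod_cast hp.1
      have h2 : (0 : ℝ) < p.2 := by exact_mod_cast hp.1.trans hp.2.1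
      rw [hφL _ (by positivity), hφL _ (by positivity)]
      ring
    · rfl
  have hsplit := tsum_coprime_le_add_tsum_coprime_ge
    (summable_norm_of_le_rpow (hB ξ hξre Q hQ0)) (summable_norm_of_le_rpow (hB η hηre Q hQ0))
    (by simp [zero_cpow (hne ξ hξre)]) (by simp [zero_cpow (hne η hηre)])
  have hone : φ (1 / Q) ^ 2 =
      (lineTransform φt ((1 : ℕ) / Q) * ((1 : ℕ) : ℂ) ^ (-1 - ξ)) *
        (lineTransform φt ((1 : ℕ) / Q) * ((1 : ℕ) : ℂ) ^ (-1 - η)) := by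
    rw [hφL _ (by positivity)]
    simp [sq]
  rw [hS', hS', hone, hsplit]
  exact hK Q hQ0
end

section
/- Let ξ ∈ ℂ with ξ ≠ 0 and |Re ξ| ≤ 1/10. Let g : ℂ → ℂ be holomorphic on the closed strip {s : -1/2 ≤ Re s ≤ 2} except for a simple pole at s = 0 with residue 1, with g(-ξ) = 0, and suppose there is a constant C such that |g(s)| ≤ C(1+|Im s|)^{-3} for all s in the strip with |Im s| ≥ 1. Then there exists a constant C' such that for all real x ≥ 1: |(1/2π) ∫_ℝ g(1+it) ζ(2+ξ+it) x^{1+it} dt − ζ(1+ξ)| ≤ C' x^{-1/3}. (That is, the vertical-line integral (1/2πi)∫_{Re w = 1} g(w) ζ(w+1+ξ) x^w dw equals ζ(1+ξ) + O(x^{-1/3}); the main term arises from the residue at w = 0, and the potential pole of ζ(w+1+ξ) at w = -ξ is cancelled by the zero of g at -ξ.) -/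
open Complex MeasureTheory Real
open Filter Topology Set

/-- The fractional part on `(1, ∞)`, whose Mellin transform continues `ζ`. -/
noncomputable def fractTail : ℝ → ℂ := (Ioi (1 : ℝ)).indicator fun t ↦ ((Int.fract t : ℝ) : ℂ)

lemma norm_fractTail_le_one (t : ℝ) : ‖fractTail t‖ ≤ 1 := by
  unfold fractTail
  by_cases ht : t ∈ Ioi (1 : ℝ)
  · rw [indicator_of_mem ht, norm_real, Real.norm_of_nonneg (Int.fract_nonneg t)]
    exact (Int.fract_lt_one t).le
  · simp [indicator_of_notMem ht]

lemma measurable_fractTail : Measurable fractTail :=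
  (Complex.measurable_ofReal.comp measurable_fract).indicator measurableSet_Ioi

lemma locallyIntegrableOn_fractTail : LocallyIntegrableOn fractTail (Ioi 0) := by
  refine ((locallyIntegrable_const (1 : ℝ)).mono
    measurable_fractTail.aestronglyMeasurable ?_).locallyIntegrableOn _
  exact ae_of_all _ fun t ↦ by simpa using norm_fractTail_le_one t

lemma fractTail_isBigO_atTop : fractTail =O[atTop] ((· ^ (-(0 : ℝ))) : ℝ → ℝ) := by
  refine Asymptotics.IsBigO.of_bound 1 (Eventually.of_forall fun t ↦ ?_)
  simpa using norm_fractTail_le_one t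

lemma fractTail_isBigO_nhds_zero (b : ℝ) : fractTail =O[𝓝[>] 0] ((· ^ (-b)) : ℝ → ℝ) := by
  have : fractTail =ᶠ[𝓝[>] 0] fun _ ↦ 0 := by
    filter_upwards [nhdsWithin_le_nhds (Iio_mem_nhds (show (0 : ℝ) < 1 by norm_num))] with t ht
    exact indicator_of_notMem (not_lt.mpr (le_of_lt ht)) _
  exact this.trans_isBigO (Asymptotics.isBigO_zero _ _)

lemma differentiableAt_mellin_fractTail {s : ℂ} (hs : s.re < 0) :
    DifferentiableAt ℂ (mellin fractTail) s :=
  mellin_differentiableAt_of_isBigO_rpow locallyIntegrableOn_fractTail fractTail_isBigO_atTop hs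
    (fractTail_isBigO_nhds_zero (s.re - 1)) (by linarith)

lemma mellin_fractTail_eq (s : ℂ) :
    mellin fractTail s = ∫ t in Ioi (1 : ℝ), (t : ℂ) ^ (s - 1) * ((Int.fract t : ℝ) : ℂ) := by
  have h : ∀ t : ℝ, (t : ℂ) ^ (s - 1) • fractTail t =
      (Ioi (1 : ℝ)).indicator (fun t : ℝ ↦ (t : ℂ) ^ (s - 1) * ((Int.fract t : ℝ) : ℂ)) t := by
    intro t
    by_cases ht : t ∈ Ioi (1 : ℝ) <;> simp [fractTail, ht]
  simp_rw [mellin, h]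
  rw [setIntegral_indicator measurableSet_Ioi,
    inter_eq_right.mpr (Ioi_subset_Ioi zero_le_one)]

lemma norm_mellin_fractTail_le {s : ℂ} (hs : s.re < 0) : ‖mellin fractTail s‖ ≤ 1 / (-s.re) := by
  rw [mellin_fractTail_eq]
  have hint := integrableOn_Ioi_rpow_of_lt (a := s.re - 1) (by linarith) zero_lt_one
  refine (norm_integral_le_of_norm_le hint ?_).trans ?_
  · filter_upwards [ae_restrict_mem measurableSet_Ioi] with t ht
    have ht0 : 0 < t := zero_lt_one.trans ht
    rw [norm_mul, norm_cpow_eq_rpow_re_of_pos ht0, norm_real,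
      Real.norm_of_nonneg (Int.fract_nonneg t), sub_re, one_re]
    exact mul_le_of_le_one_right (by positivity) (Int.fract_lt_one t).le
  · rw [integral_Ioi_rpow_of_lt (by linarith) zero_lt_one]
    simp [neg_div, div_neg]

lemma riemannZeta_eq_sub_mellin_fractTail_of_one_lt_re {s : ℂ} (hs : 1 < s.re) :
    riemannZeta s = s / (s - 1) - s * mellin fractTail (-s) := by
  have hO : (fun n : ℕ ↦ ∑ k ∈ Finset.Icc 1 n, ‖(1 : ℕ → ℂ) k‖) =O[atTop]
      fun n ↦ (n : ℝ) ^ (1 : ℝ) := by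
    simpa using Asymptotics.isBigO_refl _ _
  have hs1 : s - 1 ≠ 0 := fun h ↦ by
    rw [sub_eq_zero] at h; simp [h] at hs
  rw [← LSeries_one_eq_riemannZeta hs, LSeries_eq_mul_integral' 1 zero_le_one hs hO,
    mellin_fractTail_eq]
  have h1 : IntegrableOn (fun t : ℝ ↦ (t : ℂ) ^ (-s)) (Ioi 1) :=
    integrableOn_Ioi_cpow_of_lt (by simpa using hs) zero_lt_one
  have h2 : IntegrableOn (fun t : ℝ ↦ (t : ℂ) ^ (-s - 1) * ((Int.fract t : ℝ) : ℂ)) (Ioi 1) := by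
    refine (integrableOn_Ioi_cpow_of_lt (a := -s - 1) (by simp; linarith) zero_lt_one).mul_bdd
      (c := 1) (Complex.measurable_ofReal.comp measurable_fract).aestronglyMeasurable
      (ae_of_all _ fun t ↦ ?_)
    rw [norm_real, Real.norm_of_nonneg (Int.fract_nonneg t)]
    exact (Int.fract_lt_one t).le
  have h3 : ∫ t in Ioi (1 : ℝ), (∑ k ∈ Finset.Icc 1 ⌊t⌋₊, (1 : ℕ → ℂ) k) * (t : ℂ) ^ (-(s + 1)) =
      ∫ t in Ioi (1 : ℝ), ((t : ℂ) ^ (-s) - (t : ℂ) ^ (-s - 1) * ((Int.fract t : ℝ) : ℂ)) := by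
    refine setIntegral_congr_fun measurableSet_Ioi fun t ht ↦ ?_
    have ht0 : 0 < t := zero_lt_one.trans ht
    have hfl : ((⌊t⌋₊ : ℝ) : ℂ) = t - ((Int.fract t : ℝ) : ℂ) := by
      rw [natCast_floor_eq_intCast_floor ht0.le, ← ofReal_sub, Int.self_sub_fract]
    have hp : (t : ℂ) ^ (-s) = t * (t : ℂ) ^ (-s - 1) := by
      rw [cpow_sub _ _ (ofReal_ne_zero.mpr ht0.ne'), cpow_one]
      field_simp [ofReal_ne_zero.mpr ht0.ne']
    simp only [Pi.one_apply, Finset.sum_const, Nat.card_Icc, add_tsub_cancel_right, nsmul_eq_mul,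
      mul_one]
    rw [← ofReal_natCast, hfl, hp, neg_add']
    ring
  rw [h3, integral_sub h1 h2, integral_Ioi_cpow_of_lt (by simpa using hs) zero_lt_one, mul_sub]
  congr 1
  have : -s + 1 ≠ 0 := fun h ↦ hs1 (by linear_combination -h)
  rw [ofReal_one, one_cpow]
  field_simp
  ring

lemma riemannZeta₀_eq_one_sub_mellin_fractTail {s : ℂ} (hs : 0 < s.re) :
    riemannZeta₀ s = 1 - s * mellin fractTail (-s) := by
  have hopen : IsOpen {s : ℂ | 0 < s.re} := isOpen_lt continuous_const continuous_re
  have hA : AnalyticOnNhd ℂ riemannZeta₀ {s : ℂ | 0 < s.re} :=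
    differentiable_riemannZeta₀.differentiableOn.analyticOnNhd hopen
  have hB : AnalyticOnNhd ℂ (fun s ↦ 1 - s * mellin fractTail (-s)) {s : ℂ | 0 < s.re} := by
    refine DifferentiableOn.analyticOnNhd (fun z hz ↦ ?_) hopen
    have hz' : (-z).re < 0 := by simpa using hz
    have := (differentiableAt_mellin_fractTail hz').comp z differentiableAt_id.neg
    exact ((differentiableAt_id.mul this).const_sub 1).differentiableWithinAt
  refine hA.eqOn_of_preconnected_of_eventuallyEq hB (convex_halfSpace_re_gt 0).isPreconnected
    (show (2 : ℂ) ∈ {s : ℂ | 0 < s.re} by simp) ?_ hs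
  filter_upwards [(isOpen_lt continuous_const continuous_re).mem_nhds
    (show (1 : ℝ) < (2 : ℂ).re by simp)] with z hz
  have hz1 : z ≠ 1 := fun h ↦ by simp [h] at hz
  have hz2 := riemannZeta_eq_sub_mellin_fractTail_of_one_lt_re hz
  rw [riemannZeta_eq_inv_sub_add hz1] at hz2
  have hz3 : z / (z - 1) = 1 + (z - 1)⁻¹ := by
    field_simp [sub_ne_zero.mpr hz1]
    ring
  linear_combination hz2 + hz3

lemma norm_riemannZeta₀_le {s : ℂ} (hs : 1 / 2 ≤ s.re) : ‖riemannZeta₀ s‖ ≤ 1 + 2 * ‖s‖ := by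
  rw [riemannZeta₀_eq_one_sub_mellin_fractTail (by linarith)]
  have h : ‖mellin fractTail (-s)‖ ≤ 2 := by
    refine (norm_mellin_fractTail_le (by rw [neg_re]; linarith)).trans ?_
    rw [neg_re, neg_neg, div_le_iff₀ (by linarith)]
    linarith
  refine (norm_sub_le _ _).trans ?_
  rw [norm_one, norm_mul]
  nlinarith [norm_nonneg s]

lemma norm_riemannZeta_le {s : ℂ} (hs : 1 / 2 ≤ s.re) (him : 1 ≤ |s.im|) :
    ‖riemannZeta s‖ ≤ 2 + 2 * ‖s‖ := by
  have hs1 : s ≠ 1 := fun h ↦ by norm_num [h] at him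
  have h1 : 1 ≤ ‖s - 1‖ := him.trans (by simpa using abs_im_le_norm (s - 1))
  rw [riemannZeta_eq_inv_sub_add hs1]
  refine (norm_add_le _ _).trans ?_
  rw [norm_inv]
  linarith [norm_riemannZeta₀_le hs, inv_le_one_of_one_le₀ h1]

lemma integrable_of_continuous_of_norm_le {f : ℝ → ℂ} (hf : Continuous f) {K T₀ : ℝ}
    (hK : ∀ t, T₀ ≤ |t| → ‖f t‖ ≤ K / (1 + t ^ 2)) : Integrable f := by
  have hbound : ∀ t, T₀ ≤ |t| → ‖f t‖ ≤ K * ‖(1 + t ^ 2)⁻¹‖ := fun t ht ↦ by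
    rw [Real.norm_of_nonneg (by positivity), ← div_eq_mul_inv]
    exact hK t ht
  refine hf.locallyIntegrable.integrable_of_isBigO_atBot_atTop
    (g := fun t ↦ (1 + t ^ 2)⁻¹) (g' := fun t ↦ (1 + t ^ 2)⁻¹) ?_
    (integrable_inv_one_add_sq.integrableAtFilter _) ?_
    (integrable_inv_one_add_sq.integrableAtFilter _)
  · refine Asymptotics.IsBigO.of_bound K ?_
    filter_upwards [eventually_le_atBot (-T₀)] with t ht
    exact hbound t (by linarith [neg_le_abs t])
  · refine Asymptotics.IsBigO.of_bound K ?_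
    filter_upwards [eventually_ge_atTop T₀] with t ht
    exact hbound t (ht.trans (le_abs_self t))

lemma add_mul_I_ne_zero {a : ℝ} (ha : a ≠ 0) (t : ℝ) : (a : ℂ) + t * I ≠ 0 := fun h ↦ by
  simpa [ha] using congrArg re h

lemma integral_inv_add_mul_I {a : ℝ} (ha : a ≠ 0) (T : ℝ) :
    ∫ t in -T..T, ((a : ℂ) + t * I)⁻¹ = ((2 * Real.arctan (T / a) : ℝ) : ℂ) := by
  have hpos : ∀ t : ℝ, 0 < a ^ 2 + t ^ 2 := fun t ↦ by positivity
  have hd : ∀ t : ℝ, HasDerivAt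
      (fun t : ℝ ↦ ((Real.arctan (t / a) : ℝ) : ℂ) - I / 2 * ((Real.log (a ^ 2 + t ^ 2) : ℝ) : ℂ))
      (((a : ℂ) + t * I)⁻¹) t := by
    intro t
    have h1 := ((hasDerivAt_id t).div_const a).arctan.ofReal_comp
    have h2 := (((hasDerivAt_id t).pow 2).const_add (a ^ 2)).log (hpos t).ne'
    refine (h1.sub (h2.ofReal_comp.const_mul (I / 2))).congr_deriv ?_
    have hz := add_mul_I_ne_zero ha t
    have h3 : ((a : ℂ) ^ 2 + (t : ℂ) ^ 2) ≠ 0 := by exact_mod_cast (hpos t).ne'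
    have ha' : (a : ℂ) ≠ 0 := by exact_mod_cast ha
    have h4 : ((a : ℂ) + t * I)⁻¹ = (a - t * I) / ((a : ℂ) ^ 2 + (t : ℂ) ^ 2) := by
      rw [inv_eq_one_div, div_eq_div_iff hz h3]
      linear_combination (t : ℂ) ^ 2 * I_sq
    rw [h4]
    simp only [id, Pi.pow_apply]
    push_cast
    field_simp
  rw [intervalIntegral.integral_eq_sub_of_hasDerivAt (fun t _ ↦ hd t)]
  · rw [neg_sq, neg_div, Real.arctan_neg]
    push_cast
    ring
  · refine Continuous.intervalIntegrable ?_ _ _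
    exact (by fun_prop : Continuous fun t : ℝ ↦ (a : ℂ) + t * I).inv₀ (add_mul_I_ne_zero ha)

lemma tendsto_integral_inv_add_mul_I_sub {a b : ℝ} (ha : a < 0) (hb : 0 < b) :
    Tendsto (fun T : ℝ ↦ (∫ t in -T..T, ((b : ℂ) + t * I)⁻¹) - ∫ t in -T..T, ((a : ℂ) + t * I)⁻¹)
      atTop (𝓝 (2 * π)) := by
  simp_rw [integral_inv_add_mul_I ha.ne, integral_inv_add_mul_I hb.ne', ← ofReal_sub]
  have h1 : Tendsto (fun T : ℝ ↦ Real.arctan (T / b)) atTop (𝓝 (π / 2)) :=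
    (tendsto_arctan_atTop.mono_right nhdsWithin_le_nhds).comp (tendsto_id.atTop_div_const hb)
  have h2 : Tendsto (fun T : ℝ ↦ Real.arctan (T / a)) atTop (𝓝 (-(π / 2))) :=
    (tendsto_arctan_atBot.mono_right nhdsWithin_le_nhds).comp
      (tendsto_id.atTop_div_const_of_neg ha)
  have h3 := (continuous_ofReal.tendsto _).comp ((h1.const_mul 2).sub (h2.const_mul 2))
  rwa [show 2 * (π / 2) - 2 * -(π / 2) = 2 * π by ring, ofReal_mul, ofReal_ofNat] at h3

/-- Moving a vertical line integral of `H w / w` across the pole at the origin. -/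
lemma integral_vertical_sub_integral_vertical {H : ℂ → ℂ} {U : Set ℂ} (hU : IsOpen U)
    (hH : DifferentiableOn ℂ H U) {a b : ℝ} (ha : a < 0) (hb : 0 < b)
    (hsub : ∀ w : ℂ, a ≤ w.re → w.re ≤ b → w ∈ U) {K T₀ : ℝ}
    (hK : ∀ w : ℂ, a ≤ w.re → w.re ≤ b → T₀ ≤ |w.im| → ‖H w / w‖ ≤ K / (1 + w.im ^ 2)) :
    (∫ t : ℝ, H (b + t * I) / (b + t * I)) - ∫ t : ℝ, H (a + t * I) / (a + t * I) =
      2 * π * H 0 := by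
  have hab : a ≤ b := (ha.trans hb).le
  have hcont : ∀ c : ℝ, c ≠ 0 → a ≤ c → c ≤ b →
      Continuous fun t : ℝ ↦ H (c + t * I) / (c + t * I) := fun c hc h1 h2 ↦ by
    refine Continuous.div ?_ (by fun_prop) (add_mul_I_ne_zero hc)
    exact hH.continuousOn.comp_continuous (by fun_prop)
      fun t ↦ hsub _ (by simpa using h1) (by simpa using h2)
  have hlim : ∀ c : ℝ, c ≠ 0 → a ≤ c → c ≤ b →
      Tendsto (fun T : ℝ ↦ ∫ t in -T..T, H (c + t * I) / (c + t * I)) atTop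
        (𝓝 (∫ t : ℝ, H (c + t * I) / (c + t * I))) := fun c hc h1 h2 ↦
    intervalIntegral_tendsto_integral
      (integrable_of_continuous_of_norm_le (hcont c hc h1 h2) (K := K) (T₀ := T₀) fun t ht ↦ by
        simpa using hK (c + t * I) (by simpa using h1) (by simpa using h2) (by simpa using ht))
      tendsto_neg_atTop_atBot tendsto_id
  have hE : DifferentiableOn ℂ (dslope H 0) U :=
    (differentiableOn_dslope (hU.mem_nhds (hsub 0 (by simpa using ha.le) (by simpa using hb.le)))).2
      hH
  have hEeq : ∀ w : ℂ, w ≠ 0 → dslope H 0 w = H w / w - H 0 * w⁻¹ := fun w hw ↦ by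
    rw [dslope_of_ne _ hw, slope_def_field]
    field_simp
    ring
  have hrect : ∀ T : ℝ, (∫ x in a..b, dslope H 0 (x + (-T : ℝ) * I)) -
      (∫ x in a..b, dslope H 0 (x + T * I)) +
      I * (∫ t in -T..T, dslope H 0 (b + t * I)) - I * (∫ t in -T..T, dslope H 0 (a + t * I)) =
        0 := fun T ↦ by
    have := integral_boundary_rect_eq_zero_of_differentiableOn (dslope H 0) (⟨a, -T⟩ : ℂ) ⟨b, T⟩
      (hE.mono fun w hw ↦ by
        rw [mem_reProdIm, uIcc_of_le hab] at hw
        exact hsub w hw.1.1 hw.1.2)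
    simpa using this
  have hvert : ∀ c : ℝ, c ≠ 0 → a ≤ c → c ≤ b → ∀ T : ℝ,
      ∫ t in -T..T, dslope H 0 (c + t * I) = (∫ t in -T..T, H (c + t * I) / (c + t * I)) -
        H 0 * ∫ t in -T..T, ((c : ℂ) + t * I)⁻¹ := fun c hc h1 h2 T ↦ by
    rw [← intervalIntegral.integral_const_mul, ← intervalIntegral.integral_sub]
    · exact intervalIntegral.integral_congr fun t _ ↦ hEeq _ (add_mul_I_ne_zero hc t)
    · exact (hcont c hc h1 h2).intervalIntegrable _ _
    · refine (continuous_const.mul ?_).intervalIntegrable _ _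
      exact (by fun_prop : Continuous fun t : ℝ ↦ (c : ℂ) + t * I).inv₀ (add_mul_I_ne_zero hc)
  have hhor : ∀ ε : ℝ, |ε| = 1 → Tendsto (fun T : ℝ ↦ ∫ x in a..b, dslope H 0 (x + (ε * T : ℝ) * I))
      atTop (𝓝 0) := fun ε hε ↦ by
    have hbd : Tendsto (fun T : ℝ ↦ (K / (1 + T ^ 2) + ‖H 0‖ * T⁻¹) * |b - a|) atTop (𝓝 0) := by
      have h1 : Tendsto (fun T : ℝ ↦ K / (1 + T ^ 2)) atTop (𝓝 0) :=
        tendsto_const_nhds.div_atTop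
          (tendsto_atTop_add_const_left _ _ (tendsto_pow_atTop two_ne_zero))
      simpa using (h1.add (tendsto_inv_atTop_zero.const_mul ‖H 0‖)).mul_const |b - a|
    refine squeeze_zero_norm' ?_ hbd
    filter_upwards [eventually_ge_atTop T₀, eventually_gt_atTop 0] with T hT hT0
    refine intervalIntegral.norm_integral_le_of_norm_le_const fun x hx ↦ ?_
    rw [uIoc_of_le hab] at hx
    have him : |((x : ℂ) + (ε * T : ℝ) * I).im| = T := by
      simp [abs_mul, hε, abs_of_pos hT0]
    have hne : (x : ℂ) + (ε * T : ℝ) * I ≠ 0 := fun h ↦ by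
      rw [h] at him; simp at him; exact hT0.ne him
    have hn : T ≤ ‖(x : ℂ) + (ε * T : ℝ) * I‖ := him.symm.le.trans (abs_im_le_norm _)
    have hk := hK (x + (ε * T : ℝ) * I) (by simpa using hx.1.le) (by simpa using hx.2)
      (by rwa [him])
    rw [← sq_abs, him] at hk
    rw [hEeq _ hne]
    refine (norm_sub_le _ _).trans (add_le_add hk ?_)
    rw [norm_mul, norm_inv]
    gcongr
  have hlimE : Tendsto (fun T : ℝ ↦ I * ((∫ t in -T..T, dslope H 0 (b + t * I)) -
      ∫ t in -T..T, dslope H 0 (a + t * I))) atTop (𝓝 0) := by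
    have h1 := (hhor 1 (by simp)).sub (hhor (-1) (by simp))
    rw [sub_zero] at h1
    refine h1.congr fun T ↦ ?_
    rw [one_mul, neg_one_mul]
    linear_combination -hrect T
  have hlim2 := (((hlim b hb.ne' hab le_rfl).sub (hlim a ha.ne le_rfl hab)).sub
    ((tendsto_integral_inv_add_mul_I_sub ha hb).const_mul (H 0))).const_mul I
  have := tendsto_nhds_unique hlimE (hlim2.congr fun T ↦ by
    rw [hvert b hb.ne' hab le_rfl, hvert a ha.ne le_rfl hab]; ring)
  have h0 := (mul_eq_zero.mp this.symm).resolve_left I_ne_zero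
  linear_combination h0

/-- Let `g` be holomorphic on the closed strip `-1/2 ≤ Re s ≤ 2` except
for a simple pole at `s = 0` with residue `1` (encoded: `g(s) = g₀(s) + 1/s` with `g₀`
holomorphic on the strip), with `g(-ξ) = 0` and decay `|g(s)| ≤ C(1+|Im s|)^{-3}` for
`|Im s| ≥ 1` in the strip, where `ξ ≠ 0` and `|Re ξ| ≤ 1/10`. Then for all `x ≥ 1`,
`(1/2πi)∫_{Re w = 1} g(w) ζ(w+1+ξ) x^w dw = ζ(1+ξ) + O(x^{-1/3})`. -/
theorem stmt_1 (ξ : ℂ) (hξ : ξ ≠ 0) (hξre : |ξ.re| ≤ 1 / 10)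
    (g : ℂ → ℂ)
    (hg : ∃ g₀ : ℂ → ℂ, DifferentiableOn ℂ g₀ {s : ℂ | -(1 / 2) ≤ s.re ∧ s.re ≤ 2} ∧
      ∀ s ∈ {s : ℂ | -(1 / 2) ≤ s.re ∧ s.re ≤ 2}, s ≠ 0 → g s = g₀ s + 1 / s)
    (hzero : g (-ξ) = 0)
    (C : ℝ)
    (hdecay : ∀ s ∈ {s : ℂ | -(1 / 2) ≤ s.re ∧ s.re ≤ 2}, 1 ≤ |s.im| →
      ‖g s‖ ≤ C / (1 + |s.im|) ^ 3) :
    ∃ C' : ℝ, ∀ x : ℝ, 1 ≤ x →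
      ‖(1 / (2 * π)) * (∫ t : ℝ, g (1 + I * t) * riemannZeta (2 + ξ + I * t) *
          (x : ℂ) ^ ((1 : ℂ) + I * t)) - riemannZeta (1 + ξ)‖ ≤ C' * x ^ (-(1 / 3) : ℝ) := by
  obtain ⟨g₀, hg₀, hgeq⟩ := hg
  have hξre' := abs_le.mp hξre
  set U : Set ℂ := {w | -(1 / 2) < w.re ∧ w.re < 2}
  have hU : IsOpen U :=
    (isOpen_lt continuous_const continuous_re).inter (isOpen_lt continuous_re continuous_const)
  have hUS : U ⊆ {s : ℂ | -(1 / 2) ≤ s.re ∧ s.re ≤ 2} := fun w hw ↦ ⟨hw.1.le, hw.2.le⟩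
  have hξU : -ξ ∈ U := ⟨by rw [neg_re]; linarith, by rw [neg_re]; linarith⟩
  set k : ℂ → ℂ := fun w ↦ w * g₀ w + 1 with hk
  have hkd : DifferentiableOn ℂ k U := (differentiableOn_id.mul (hg₀.mono hUS)).add_const 1
  have hkg : ∀ w ∈ U, w ≠ 0 → k w = w * g w := fun w hw hw0 ↦ by
    rw [hgeq w (hUS hw) hw0, hk]
    field_simp
  have hkξ : k (-ξ) = 0 := by rw [hkg _ hξU (neg_ne_zero.mpr hξ), hzero, mul_zero]
  have hk1 : ∀ w, w ≠ -ξ → dslope k (-ξ) w = k w / (w + ξ) := fun w hw ↦ by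
    rw [dslope_of_ne _ hw, slope_def_field, hkξ, sub_zero, sub_neg_eq_add]
  have hk1d : DifferentiableOn ℂ (dslope k (-ξ)) U :=
    (differentiableOn_dslope (hU.mem_nhds hξU)).2 hkd
  have hbound : ∀ w : ℂ, -(1 / 3) ≤ w.re → w.re ≤ 1 → |ξ.im| + 1 ≤ |w.im| →
      ‖g w * riemannZeta (w + 1 + ξ)‖ ≤ (|C| * (7 + 2 * |ξ.im|)) / (1 + w.im ^ 2) := by
    intro w h1 h2 h3
    have hgw := hdecay w ⟨by linarith, by linarith⟩ (by linarith [abs_nonneg ξ.im])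
    have him : (w + 1 + ξ).im = w.im + ξ.im := by simp
    have hre : (w + 1 + ξ).re = w.re + 1 + ξ.re := by simp
    have hζ := norm_riemannZeta_le (s := w + 1 + ξ) (by rw [hre]; linarith) (by
      rw [him]
      have := abs_sub_abs_le_abs_sub w.im (-ξ.im)
      rw [abs_neg, sub_neg_eq_add] at this
      linarith)
    have hs := norm_le_abs_re_add_abs_im (w + 1 + ξ)
    rw [him, hre, abs_of_nonneg (by linarith : 0 ≤ w.re + 1 + ξ.re)] at hs
    have hadd := abs_add_le w.im ξ.im
    have hw0 := abs_nonneg w.im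
    have hξ0 := abs_nonneg ξ.im
    have hζ' : ‖riemannZeta (w + 1 + ξ)‖ ≤ (7 + 2 * |ξ.im|) * (1 + |w.im|) := by nlinarith
    have hg' : ‖g w‖ ≤ |C| / (1 + |w.im|) ^ 3 :=
      hgw.trans (by gcongr; exact le_abs_self C)
    rw [norm_mul]
    calc ‖g w‖ * ‖riemannZeta (w + 1 + ξ)‖
        ≤ |C| / (1 + |w.im|) ^ 3 * ((7 + 2 * |ξ.im|) * (1 + |w.im|)) := by gcongr
      _ = (|C| * (7 + 2 * |ξ.im|)) / (1 + |w.im|) ^ 2 := by field_simp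
      _ ≤ (|C| * (7 + 2 * |ξ.im|)) / (1 + w.im ^ 2) := by
          gcongr
          nlinarith [sq_abs w.im]
  refine ⟨1 / (2 * π) * ∫ t : ℝ, ‖g ((-(1 / 3) : ℝ) + t * I) *
    riemannZeta ((-(1 / 3) : ℝ) + t * I + 1 + ξ)‖, fun x hx ↦ ?_⟩
  have hx0 : 0 < x := zero_lt_one.trans_le hx
  have hxc : (x : ℂ) ≠ 0 := ofReal_ne_zero.mpr hx0.ne'
  set H : ℂ → ℂ := fun w ↦ dslope k (-ξ) w * riemannZeta₁ (w + 1 + ξ) * (x : ℂ) ^ w with hH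
  have hHd : DifferentiableOn ℂ H U := by
    refine (hk1d.mul ?_).mul ?_
    · exact (differentiable_riemannZeta₁.comp (by fun_prop)).differentiableOn
    · exact (differentiable_id.const_cpow (.inl hxc)).differentiableOn
  have hHeq : ∀ w ∈ U, w ≠ 0 → w ≠ -ξ →
      H w / w = g w * riemannZeta (w + 1 + ξ) * (x : ℂ) ^ w := fun w hw hw0 hwξ ↦ by
    have hne : w + ξ ≠ 0 := fun h ↦ hwξ (eq_neg_of_add_eq_zero_left h)
    have hne1 : w + 1 + ξ ≠ 1 := fun h ↦ hne (by linear_combination h)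
    rw [riemannZeta_eq_inv_sub_mul hne1, hH]
    simp only
    rw [hk1 w hwξ, hkg w hw hw0, show w + 1 + ξ - 1 = w + ξ by ring]
    field_simp
  have hH0 : H 0 = riemannZeta (1 + ξ) := by
    rw [riemannZeta_eq_inv_sub_mul (by simpa using hξ), hH]
    simp only
    rw [hk1 0 (neg_ne_zero.mpr hξ).symm]
    simp [hk]
  have hmem : ∀ w : ℂ, -(1 / 3) ≤ w.re → w.re ≤ 1 → w ∈ U := fun w h1 h2 ↦
    ⟨by linarith, by linarith⟩
  have hshift := integral_vertical_sub_integral_vertical hU hHd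
    (a := -(1 / 3)) (b := 1) (by norm_num) one_pos hmem
    (K := |C| * (7 + 2 * |ξ.im|) * x) (T₀ := |ξ.im| + 1) (by
      intro w h1 h2 h3
      have hw0 : w ≠ 0 := fun h ↦ by
        rw [h, zero_im, abs_zero] at h3; linarith [abs_nonneg ξ.im]
      have hwξ : w ≠ -ξ := fun h ↦ by
        rw [h, neg_im, abs_neg] at h3; linarith
      rw [hHeq w (hmem w h1 h2) hw0 hwξ, norm_mul, norm_cpow_eq_rpow_re_of_pos hx0,
        mul_div_right_comm]
      gcongr
      · exact hbound w h1 h2 h3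
      · simpa using rpow_le_rpow_of_exponent_le hx h2)
  have hline : ∀ c : ℝ, -(1 / 3) ≤ c → c ≤ 1 → 1 / 10 < |c| → ∀ t : ℝ,
      H (c + t * I) / (c + t * I) =
        g (c + t * I) * riemannZeta (c + t * I + 1 + ξ) * (x : ℂ) ^ ((c : ℂ) + t * I) := by
    intro c h1 h2 h3 t
    have hre : ((c : ℂ) + t * I).re = c := by simp
    refine hHeq _ (hmem _ (by rwa [hre]) (by rwa [hre])) (fun h ↦ ?_) (fun h ↦ ?_)
    · rw [h, zero_re] at hre
      norm_num [← hre] at h3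
    · rw [h, neg_re] at hre
      rw [← hre, abs_neg] at h3
      linarith
  simp_rw [hline 1 (by norm_num) le_rfl (by norm_num),
    hline (-(1 / 3)) le_rfl (by norm_num) (by norm_num), hH0] at hshift
  have hleft : (∫ t : ℝ, g (1 + I * t) * riemannZeta (2 + ξ + I * t) *
      (x : ℂ) ^ ((1 : ℂ) + I * t)) = ∫ t : ℝ, g ((1 : ℝ) + t * I) *
        riemannZeta ((1 : ℝ) + t * I + 1 + ξ) * (x : ℂ) ^ (((1 : ℝ) : ℂ) + t * I) := by
    refine integral_congr_ae (ae_of_all _ fun t ↦ ?_)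
    simp only
    rw [ofReal_one, mul_comm I, show (1 : ℂ) + t * I + 1 + ξ = 2 + ξ + t * I by ring]
  have hπ : (π : ℂ) ≠ 0 := ofReal_ne_zero.mpr pi_ne_zero
  rw [hleft, eq_add_of_sub_eq hshift, mul_add, show (1 / (2 * (π : ℂ))) *
    (2 * π * riemannZeta (1 + ξ)) = riemannZeta (1 + ξ) by field_simp, add_sub_cancel_left,
    norm_mul, mul_assoc, ← integral_mul_const]
  gcongr
  · simp [abs_of_pos pi_pos]
  · refine (norm_integral_le_integral_norm _).trans_eq
      (integral_congr_ae (ae_of_all _ fun t ↦ ?_))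
    simp only
    rw [norm_mul, norm_cpow_eq_rpow_re_of_pos hx0]
    simp
end

section
/- Let Q be a positive integer and let a/b < c/d be two fractions in [0,1] with a, c ≥ 0 integers, b, d positive integers satisfying b ≤ Q, d ≤ Q, gcd(a,b) = 1, gcd(c,d) = 1, and suppose there is no rational number p/q with 1 ≤ q ≤ Q lying strictly between a/b and c/d. Then c/d − a/b = 1/(bd) ≥ 1/Q². -/
/-- The solutions of `b * p - a * q = 1` can be chosen with `q` in any given window of
length `b`. -/
lemma exists_bezout_in_window {a b : ℤ} (Q : ℤ) (hb : 0 < b) (hab : Int.gcd a b = 1) :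
    ∃ p q : ℤ, b * p - a * q = 1 ∧ Q - b < q ∧ q ≤ Q := by
  have h := Int.gcd_eq_gcd_ab a b
  rw [hab] at h
  push_cast at h
  set y := -Int.gcdA a b with hy
  refine ⟨Int.gcdB a b + a * ((Q - y) / b), y + b * ((Q - y) / b), ?_, ?_, ?_⟩
  · rw [hy]; linear_combination -h
  · linarith [Int.emod_lt_of_pos (Q - y) hb, Int.emod_add_mul_ediv (Q - y) b]
  · linarith [Int.emod_nonneg (Q - y) hb.ne', Int.emod_add_mul_ediv (Q - y) b]

/-- Adjacent Farey fractions have determinant one. -/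
lemma farey_adjacent_det_eq_one {Q a b c d : ℤ} (hb : 0 < b)
    (hbQ : b ≤ Q) (hdQ : d ≤ Q) (hlt : a * d < c * b)
    (hab : Int.gcd a b = 1) (hcd : Int.gcd c d = 1)
    (hadj : ∀ p q : ℤ, 1 ≤ q → q ≤ Q → a * q < p * b → c * q ≤ p * d) :
    c * b - a * d = 1 := by
  obtain ⟨p, q, hpq, hlo, hhi⟩ := exists_bezout_in_window Q hb hab
  have hq : 1 ≤ q := by linarith
  have hle := hadj p q hq hhi (by linarith)
  have key : d = b * (p * d - c * q) + q * (c * b - a * d) := by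
    linear_combination (-d) * hpq
  rcases hle.eq_or_lt with heq | hgt
  · have hdvd : d ∣ q := by
      refine IsCoprime.dvd_of_dvd_mul_left (Int.isCoprime_iff_gcd_eq_one.mpr ?_)
        (Dvd.intro_left p heq.symm)
      rwa [Int.gcd_comm]
    nlinarith [Int.le_of_dvd (by linarith) hdvd]
  · nlinarith

/-- STATEMENT 5: If `a/b < c/d` are adjacent Farey fractions of order `Q`
(i.e. both in `[0,1]`, in lowest terms, with denominators at most `Q`, and no
rational with denominator at most `Q` lies strictly between them), then
`c/d − a/b = 1/(bd) ≥ 1/Q²`. -/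
theorem stmt_7 (Q a b c d : ℤ) (hQ : 0 < Q)
    (hb : 0 < b) (hd : 0 < d) (hbQ : b ≤ Q) (hdQ : d ≤ Q)
    (ha : 0 ≤ a) (hc : 0 ≤ c)
    (hab1 : (a : ℚ) / b ≤ 1) (hcd1 : (c : ℚ) / d ≤ 1)
    (hlt : (a : ℚ) / b < (c : ℚ) / d)
    (hcopab : Int.gcd a b = 1) (hcopcd : Int.gcd c d = 1)
    (hadj : ¬ ∃ p q : ℤ, 1 ≤ q ∧ q ≤ Q ∧
      (a : ℚ) / b < (p : ℚ) / q ∧ (p : ℚ) / q < (c : ℚ) / d) :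
    (c : ℚ) / d - (a : ℚ) / b = 1 / (b * d) ∧ (1 : ℚ) / Q ^ 2 ≤ 1 / (b * d) := by
  have hb' : (0 : ℚ) < b := by exact_mod_cast hb
  have hd' : (0 : ℚ) < d := by exact_mod_cast hd
  have hdet : c * b - a * d = 1 := by
    refine farey_adjacent_det_eq_one hb hbQ hdQ ?_ hcopab hcopcd ?_
    · rw [div_lt_div_iff₀ hb' hd'] at hlt
      exact_mod_cast hlt
    · intro p q hq hqQ hpq
      by_contra! hcon
      have hq' : (0 : ℚ) < q := by exact_mod_cast (by linarith : 0 < q)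
      refine hadj ⟨p, q, hq, hqQ, ?_, ?_⟩
      · rw [div_lt_div_iff₀ hb' hq']
        exact_mod_cast hpq
      · rw [div_lt_div_iff₀ hq' hd']
        exact_mod_cast hcon
  have hdet' : (c : ℚ) * b - a * d = 1 := by exact_mod_cast hdet
  constructor
  · rw [div_sub_div _ _ hd'.ne' hb'.ne', mul_comm (b : ℚ) d]
    congr 1
    linarith
  · apply one_div_le_one_div_of_le (mul_pos hb' hd')
    have hbd : b * d ≤ Q ^ 2 := by nlinarith
    exact_mod_cast hbd
end

section
/- Let ψ : ℝ → ℝ be a smooth function with compact support contained in (0, ∞), and let s ∈ ℂ with 0 < Re s < 1. Then ∫_0^∞ (2 Re ψ̂(v)) v^{s−1} dv = 2(2π)^{-s} cos(πs/2) Γ(s) ∫_0^∞ ψ(t) t^{-s} dt, where ψ̂(v) = ∫_ℝ ψ(u) e(uv) du and e(x) = e^{2πix}. (The factor 2(2π)^{-s} cos(πs/2) Γ(s) equals χ(1−s), where χ(s) = 2^s π^{s−1} sin(πs/2) Γ(1−s) is the factor in the functional equation ζ(s) = χ(s)ζ(1−s).) -/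
open Complex MeasureTheory Real

section

open Set Filter Topology

lemma norm_cpow_sub_one_mul_exp_neg_mul {a z : ℂ} {t : ℝ} (ht : 0 < t) :
    ‖(t : ℂ) ^ (a - 1) * cexp (-(z * t))‖ = t ^ (a.re - 1) * rexp (-z.re * t) := by
  rw [norm_mul, norm_cpow_eq_rpow_re_of_pos ht, Complex.norm_exp]
  simp

lemma continuousOn_cpow_mul_exp_neg_mul (a z : ℂ) :
    ContinuousOn (fun t : ℝ ↦ (t : ℂ) ^ a * cexp (-(z * t))) (Ioi 0) := by
  intro t ht
  refine ContinuousAt.continuousWithinAt (ContinuousAt.mul ?_ (by fun_prop))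
  exact (continuousAt_cpow_const (ofReal_mem_slitPlane.2 ht)).comp continuous_ofReal.continuousAt

lemma integrableOn_cpow_mul_exp_neg_mul {a z : ℂ} (ha : 0 < a.re) (hz : 0 < z.re) :
    IntegrableOn (fun t : ℝ ↦ (t : ℂ) ^ (a - 1) * cexp (-(z * t))) (Ioi 0) := by
  have h := integrableOn_rpow_mul_exp_neg_mul_rpow (s := a.re - 1) (p := 1) (by linarith)
    one_pos hz
  refine Integrable.mono' h ((continuousOn_cpow_mul_exp_neg_mul _ _).aestronglyMeasurable
    measurableSet_Ioi) ?_
  filter_upwards [ae_restrict_mem measurableSet_Ioi] with t ht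
  rw [norm_cpow_sub_one_mul_exp_neg_mul ht, Real.rpow_one]

lemma differentiableOn_integral_cpow_mul_exp_neg_mul {a : ℂ} (ha : 0 < a.re) :
    DifferentiableOn ℂ (fun z : ℂ ↦ ∫ t in Ioi (0 : ℝ), (t : ℂ) ^ (a - 1) * cexp (-(z * t)))
      {z | 0 < z.re} := by
  intro z hz
  have hz : 0 < z.re := hz
  have hz2 : 0 < z.re / 2 := by linarith
  have hbound := integrableOn_rpow_mul_exp_neg_mul_rpow (s := a.re) (p := 1) (by linarith)
    one_pos hz2
  refine (hasDerivAt_integral_of_dominated_loc_of_deriv_le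
    (F := fun (w : ℂ) (t : ℝ) ↦ (t : ℂ) ^ (a - 1) * cexp (-(w * t)))
    (F' := fun (w : ℂ) (t : ℝ) ↦ (t : ℂ) ^ (a - 1) * (cexp (-(w * t)) * (-t)))
    (bound := fun t ↦ t ^ a.re * rexp (-(z.re / 2) * t ^ (1 : ℝ)))
    (Metric.ball_mem_nhds z hz2) (Eventually.of_forall fun w ↦
      (continuousOn_cpow_mul_exp_neg_mul _ _).aestronglyMeasurable measurableSet_Ioi)
    (integrableOn_cpow_mul_exp_neg_mul ha hz) ?_ ?_ hbound
    ?_).2.differentiableAt.differentiableWithinAt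
  · have : ContinuousOn (fun t : ℝ ↦ (t : ℂ) ^ (a - 1) * cexp (-(z * t)) * (-t : ℂ)) (Ioi 0) :=
      (continuousOn_cpow_mul_exp_neg_mul (a - 1) z).mul (by fun_prop)
    simpa only [mul_assoc] using this.aestronglyMeasurable measurableSet_Ioi
  · filter_upwards [ae_restrict_mem measurableSet_Ioi] with t (ht : 0 < t) w hw
    have hw' : z.re / 2 ≤ w.re := by
      have h1 := (Complex.abs_re_le_norm (w - z)).trans_lt (mem_ball_iff_norm.1 hw)
      rw [Complex.sub_re, abs_lt] at h1
      linarith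
    rw [← mul_assoc, norm_mul, norm_cpow_sub_one_mul_exp_neg_mul ht, norm_neg,
      Complex.norm_of_nonneg ht.le, Real.rpow_one, mul_right_comm, Real.rpow_sub_one ht.ne',
      div_mul_cancel₀ _ ht.ne']
    gcongr
  · filter_upwards [ae_restrict_mem measurableSet_Ioi] with t ht w hw
    have h1 : HasDerivAt (fun w : ℂ ↦ -(w * t)) (-t : ℂ) w := by
      simpa using! ((hasDerivAt_id w).mul_const (t : ℂ)).neg
    exact h1.cexp.const_mul _

lemma integral_cpow_mul_exp_neg_mul_Ioi_of_re_pos {a z : ℂ} (ha : 0 < a.re) (hz : 0 < z.re) :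
    ∫ t in Ioi (0 : ℝ), (t : ℂ) ^ (a - 1) * cexp (-(z * t)) = z ^ (-a) * Complex.Gamma a := by
  have hopen : IsOpen {z : ℂ | 0 < z.re} := isOpen_lt continuous_const continuous_re
  have hrhs : DifferentiableOn ℂ (fun z : ℂ ↦ z ^ (-a) * Complex.Gamma a) {z | 0 < z.re} :=
    fun w hw ↦ ((differentiableAt_id.cpow_const (Or.inl hw)).mul_const _).differentiableWithinAt
  have hfreq : ∃ᶠ w in 𝓝[≠] (1 : ℂ),
      ∫ t in Ioi (0 : ℝ), (t : ℂ) ^ (a - 1) * cexp (-(w * t)) = w ^ (-a) * Complex.Gamma a := by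
    have htend : Tendsto (fun x : ℝ ↦ (x : ℂ)) (𝓝[>] 1) (𝓝[≠] 1) := by
      refine tendsto_nhdsWithin_iff.2 ⟨?_, ?_⟩
      · exact (continuous_ofReal.tendsto' 1 1 (by simp)).mono_left nhdsWithin_le_nhds
      · filter_upwards [self_mem_nhdsWithin] with x hx
        simpa using ne_of_gt hx
    refine htend.frequently (Eventually.frequently ?_)
    filter_upwards [self_mem_nhdsWithin] with x hx
    have hx0 : 0 < x := one_pos.trans hx
    rw [Complex.integral_cpow_mul_exp_neg_mul_Ioi ha hx0, one_div, Complex.inv_cpow, cpow_neg]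
    rw [Complex.arg_ofReal_of_nonneg hx0.le]
    exact Real.pi_pos.ne
  exact ((differentiableOn_integral_cpow_mul_exp_neg_mul ha).analyticOnNhd
    hopen).eqOn_of_preconnected_of_frequently_eq (hrhs.analyticOnNhd hopen)
    (convex_halfSpace_re_gt 0).isPreconnected (by simp : (1 : ℂ) ∈ {z : ℂ | 0 < z.re}) hfreq hz

lemma add_I_mul_mul_mem_slitPlane {θ u : ℝ} (hθ : θ ≠ 0) (hu : 0 < u) (ε : ℝ) :
    (ε + I * θ * u : ℂ) ∈ slitPlane := by
  refine Or.inr ?_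
  simp [hθ, hu.ne']

lemma integral_exp_damping_mul_cpow_mul_integral {φ : ℝ → ℂ} (hφ : Continuous φ)
    (hc : HasCompactSupport φ) (θ : ℝ) {s : ℂ} (hs : 0 < s.re) {ε : ℝ} (hε : 0 < ε) :
    ∫ v in Ioi (0 : ℝ), cexp (-(ε * v)) *
      ((v : ℂ) ^ (s - 1) * ∫ u, φ u * cexp (-(I * θ * u * v))) =
      (∫ u, φ u * (ε + I * θ * u) ^ (-s)) * Complex.Gamma s := by
  have hint : Integrable (Function.uncurry fun v u : ℝ ↦
      ((v : ℂ) ^ (s - 1) * cexp (-(ε * v))) * (φ u) * cexp (-(I * θ * u * v)))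
      ((volume.restrict (Ioi 0)).prod volume) := by
    have h := Integrable.mul_prod (integrableOn_cpow_mul_exp_neg_mul hs
      (z := (ε : ℂ)) (by simpa using hε)) (hφ.integrable_of_hasCompactSupport (μ := volume) hc)
    refine Integrable.mul_bdd (c := 1) h (Continuous.aestronglyMeasurable (by fun_prop)) ?_
    refine Eventually.of_forall fun p ↦ ?_
    rw [Complex.norm_exp]
    simp
  calc
    _ = ∫ v in Ioi (0 : ℝ), ∫ u, ((v : ℂ) ^ (s - 1) * cexp (-(ε * v))) * (φ u) *
        cexp (-(I * θ * u * v)) := by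
      congr 1 with v
      rw [← integral_const_mul, ← integral_const_mul]
      congr 1 with u
      ring
    _ = ∫ u, ∫ v in Ioi (0 : ℝ), ((v : ℂ) ^ (s - 1) * cexp (-(ε * v))) * (φ u) *
        cexp (-(I * θ * u * v)) := integral_integral_swap hint
    _ = ∫ u, φ u * (ε + I * θ * u) ^ (-s) * Complex.Gamma s := by
      congr 1 with u
      rw [mul_assoc (φ u), ← integral_cpow_mul_exp_neg_mul_Ioi_of_re_pos hs
        (z := ε + I * θ * u) (by simpa using hε), ← integral_const_mul]
      congr 1 with v
      rw [add_mul, neg_add, Complex.exp_add]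
      ring
    _ = _ := integral_mul_const _ _

lemma mellin_integral_mul_exp {φ : ℝ → ℂ} (hφ : Continuous φ) (hc : HasCompactSupport φ)
    (hsupp : tsupport φ ⊆ Ioi 0) {θ : ℝ} (hθ : θ ≠ 0) {s : ℂ} (hs : 0 < s.re)
    (hconv : MellinConvergent (fun v ↦ ∫ u, φ u * cexp (-(I * θ * u * v))) s) :
    mellin (fun v ↦ ∫ u, φ u * cexp (-(I * θ * u * v))) s =
      (∫ u, φ u * (I * θ * u) ^ (-s)) * Complex.Gamma s := by
  have hleft : Tendsto (fun ε : ℝ ↦ ∫ v in Ioi (0 : ℝ), cexp (-(ε * v)) *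
      ((v : ℂ) ^ (s - 1) * ∫ u, φ u * cexp (-(I * θ * u * v)))) (𝓝[>] 0)
      (𝓝 (mellin (fun v ↦ ∫ u, φ u * cexp (-(I * θ * u * v))) s)) := by
    refine tendsto_integral_filter_of_dominated_convergence _ ?_ ?_ hconv.norm ?_
    · refine Eventually.of_forall fun ε ↦ ?_
      exact (Continuous.aestronglyMeasurable (by fun_prop)).mul hconv.aestronglyMeasurable
    · filter_upwards [self_mem_nhdsWithin] with ε (hε : 0 < ε)
      filter_upwards [ae_restrict_mem measurableSet_Ioi] with v (hv : 0 < v)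
      rw [norm_mul, Complex.norm_exp, smul_eq_mul]
      refine mul_le_of_le_one_left (norm_nonneg _) (Real.exp_le_one_iff.2 ?_)
      simpa using (mul_pos hε hv).le
    · refine Eventually.of_forall fun v ↦ ?_
      have : Continuous fun ε : ℝ ↦ cexp (-(ε * v)) *
        ((v : ℂ) ^ (s - 1) * ∫ u, φ u * cexp (-(I * θ * u * v))) := by fun_prop
      exact (this.tendsto' 0 _ (by simp)).mono_left nhdsWithin_le_nhds
  have hright : Tendsto (fun ε : ℝ ↦ ∫ u, φ u * (ε + I * θ * u) ^ (-s)) (𝓝[>] 0)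
      (𝓝 (∫ u, φ u * (I * θ * u) ^ (-s))) := by
    have hcont : ContinuousOn (fun p : ℝ × ℝ ↦ (p.1 + I * θ * p.2 : ℂ) ^ (-s))
        (univ ×ˢ Ioi 0) := by
      refine ContinuousOn.cpow_const (by fun_prop) fun p hp ↦ ?_
      exact add_I_mul_mul_mem_slitPlane hθ hp.2 _
    obtain ⟨C, hC⟩ := ((isCompact_Icc (a := (0 : ℝ)) (b := 1)).prod
      hc.isCompact).exists_bound_of_continuousOn
      (hcont.mono (prod_mono (subset_univ _) hsupp))
    refine tendsto_integral_filter_of_dominated_convergence (fun u ↦ ‖φ u‖ * C) ?_ ?_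
      ((hφ.integrable_of_hasCompactSupport hc).norm.mul_const C) ?_
    · refine Eventually.of_forall fun ε ↦ ?_
      refine hφ.aestronglyMeasurable.mul (Measurable.aestronglyMeasurable ?_)
      fun_prop
    · filter_upwards [Ioo_mem_nhdsGT one_pos] with ε hε
      refine Eventually.of_forall fun u ↦ ?_
      by_cases hu : u ∈ tsupport φ
      · rw [norm_mul]
        gcongr
        exact hC (ε, u) ⟨⟨hε.1.le, hε.2.le⟩, hu⟩
      · simp [image_eq_zero_of_notMem_tsupport hu]
    · refine Eventually.of_forall fun u ↦ ?_
      by_cases hu : u ∈ tsupport φ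
      · have hslit := add_I_mul_mul_mem_slitPlane hθ (hsupp hu) 0
        have : ContinuousAt (fun ε : ℝ ↦ φ u * (ε + I * θ * u) ^ (-s)) 0 :=
          continuousAt_const.mul (ContinuousAt.cpow (by fun_prop) continuousAt_const hslit)
        simpa using this.tendsto.mono_left nhdsWithin_le_nhds
      · simp [image_eq_zero_of_notMem_tsupport hu]
  refine tendsto_nhds_unique hleft ((hright.mul_const _).congr' ?_)
  filter_upwards [self_mem_nhdsWithin] with ε hε
  exact (integral_exp_damping_mul_cpow_mul_integral hφ hc θ hs hε).symm

lemma SchwartzMap.mellinConvergent (f : SchwartzMap ℝ ℂ) {s : ℂ} (hs : 0 < s.re) :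
    MellinConvergent f s := by
  refine mellinConvergent_of_isBigO_rpow (a := s.re + 1) (b := 0)
    (f.continuous.locallyIntegrable.locallyIntegrableOn _) ?_ (by linarith) ?_ hs
  · refine ((f.isBigO_cocompact_rpow (-(s.re + 1))).mono
      (atTop_le_cocompact)).congr' EventuallyEq.rfl ?_
    filter_upwards [eventually_ge_atTop 0] with x hx
    rw [Real.norm_of_nonneg hx]
  · simpa using (f.continuous.tendsto 0).mono_left nhdsWithin_le_nhds |>.isBigO_one ℝ

lemma I_mul_two_pi_mul_cpow_add_neg {u : ℝ} (hu : 0 < u) (s : ℂ) :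
    (I * (2 * π : ℝ) * u) ^ (-s) + (I * (-(2 * π) : ℝ) * u) ^ (-s) =
      2 * (2 * π : ℂ) ^ (-s) * Complex.cos (π * s / 2) * (u : ℂ) ^ (-s) := by
  have hpi : (0 : ℝ) < 2 * π := by positivity
  have hx : 0 < 2 * π * u := by positivity
  have h2 : (2 * π : ℂ) ^ (-s) * (u : ℂ) ^ (-s) = ((2 * π * u : ℝ) : ℂ) ^ (-s) := by
    have := mul_cpow_ofReal_nonneg hpi.le hu.le (-s)
    push_cast at this ⊢
    exact this.symm
  have hmul (z : ℂ) (hz : z ≠ 0) : (((2 * π * u : ℝ) : ℂ) * z) ^ (-s) =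
      ((2 * π * u : ℝ) : ℂ) ^ (-s) * cexp (Complex.log z * -s) := by
    have hx' : ((2 * π * u : ℝ) : ℂ) ≠ 0 := ofReal_ne_zero.2 hx.ne'
    rw [cpow_def_of_ne_zero (mul_ne_zero hx' hz), cpow_def_of_ne_zero hx',
      Complex.log_ofReal_mul hx hz, ofReal_log hx.le, add_mul, Complex.exp_add]
  have e1 : I * (2 * π : ℝ) * u = ((2 * π * u : ℝ) : ℂ) * I := by
    rw [ofReal_mul (2 * π) u]; ring
  have e2 : I * (-(2 * π) : ℝ) * u = ((2 * π * u : ℝ) : ℂ) * (-I) := by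
    rw [ofReal_neg, ofReal_mul (2 * π) u]; ring
  rw [e1, e2, hmul _ I_ne_zero, hmul _ (neg_ne_zero.2 I_ne_zero), log_I, log_neg_I,
    mul_right_comm _ _ ((u : ℂ) ^ (-s)), mul_assoc (2 : ℂ), h2, Complex.cos,
    show (π / 2 * I * -s : ℂ) = -(π * s / 2) * I by ring,
    show (-(π / 2) * I * -s : ℂ) = π * s / 2 * I by ring]
  ring

end

open FourierTransform ComplexConjugate Filter in
/-- For smooth `ψ : ℝ → ℝ` with compact support in `(0,∞)` and
`0 < Re s < 1`,
`∫_0^∞ (2 Re ψ̂(v)) v^{s−1} dv = 2(2π)^{-s} cos(πs/2) Γ(s) ∫_0^∞ ψ(t) t^{-s} dt`,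
where `ψ̂(v) = ∫_ℝ ψ(u) e(uv) du`. The right-hand factor is `χ(1−s)` from the
functional equation of `ζ`. -/
theorem stmt_15 (ψ : ℝ → ℝ) (hsmooth : ContDiff ℝ (⊤ : ℕ∞) ψ) (hcomp : HasCompactSupport ψ)
    (hsupp : tsupport ψ ⊆ Set.Ioi (0 : ℝ))
    (s : ℂ) (hs0 : 0 < s.re) (hs1 : s.re < 1)
    (F : ℝ → ℂ) (hF : ∀ v : ℝ, F v = ∫ u : ℝ, (ψ u : ℂ) * Complex.exp (2 * π * I * (u * v))) :
    ∫ v in Set.Ioi (0 : ℝ), ((2 * (F v).re : ℝ) : ℂ) * (v : ℂ) ^ (s - 1) =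
      2 * (2 * π : ℂ) ^ (-s) * Complex.cos (π * s / 2) * Complex.Gamma s *
        ∫ t in Set.Ioi (0 : ℝ), (ψ t : ℂ) * (t : ℂ) ^ (-s) := by
  set φ : ℝ → ℂ := fun u ↦ ψ u with hφ
  have hφs : ContDiff ℝ (⊤ : ℕ∞) φ := ofRealCLM.contDiff.comp hsmooth
  have hφc : HasCompactSupport φ := hcomp.comp_left ofReal_zero
  have hφsupp : tsupport φ ⊆ Set.Ioi 0 :=
    (closure_mono fun u hu ↦ by simpa [hφ] using hu).trans hsupp
  let f : SchwartzMap ℝ ℂ := hφc.toSchwartzMap hφs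
  have hfour : (𝓕 f : SchwartzMap ℝ ℂ) =
      fun v : ℝ ↦ ∫ u, φ u * cexp (-(I * (2 * π : ℝ) * u * v)) := by
    ext v
    rw [SchwartzMap.fourier_coe, Real.fourier_eq']
    congr 1 with u
    rw [smul_eq_mul, mul_comm]
    congr 2
    simp
    ring
  have hinv : (𝓕⁻ f : SchwartzMap ℝ ℂ) =
      fun v : ℝ ↦ ∫ u, φ u * cexp (-(I * (-(2 * π) : ℝ) * u * v)) := by
    ext v
    rw [SchwartzMap.fourierInv_coe, Real.fourierInv_eq']
    congr 1 with u
    rw [smul_eq_mul, mul_comm]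
    congr 2
    simp
    ring
  have hpi : 2 * π ≠ 0 := by positivity
  have hFinv (v : ℝ) : F v = (𝓕⁻ f : SchwartzMap ℝ ℂ) v := by
    rw [hF, hinv]
    congr 1 with u
    congr 2
    push_cast
    ring
  have hFconj (v : ℝ) : conj (F v) = (𝓕 f : SchwartzMap ℝ ℂ) v := by
    rw [hF, hfour, ← integral_conj]
    congr 1 with u
    rw [map_mul, conj_ofReal, ← Complex.exp_conj]
    congr 2
    simp [Complex.conj_ofNat]
    ring
  have hc1 := (𝓕 f : SchwartzMap ℝ ℂ).mellinConvergent hs0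
  have hc2 := (𝓕⁻ f : SchwartzMap ℝ ℂ).mellinConvergent hs0
  have hint {θ : ℝ} (hθ : θ ≠ 0) : Integrable fun u : ℝ ↦ φ u * (I * θ * u) ^ (-s) := by
    refine Continuous.integrable_of_hasCompactSupport ?_ hφc.mul_right
    refine continuous_of_tsupport fun u hu ↦ ?_
    refine hφs.continuous.continuousAt.mul (ContinuousAt.cpow (by fun_prop) continuousAt_const ?_)
    simpa using add_I_mul_mul_mem_slitPlane hθ (hφsupp (tsupport_mul_subset_left hu)) 0
  have hm1 := mellin_integral_mul_exp hφs.continuous hφc hφsupp hpi hs0 (hfour ▸ hc1)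
  have hm2 := mellin_integral_mul_exp hφs.continuous hφc hφsupp (neg_ne_zero.2 hpi) hs0
    (hinv ▸ hc2)
  calc
    _ = mellin (𝓕 f : SchwartzMap ℝ ℂ) s + mellin (𝓕⁻ f : SchwartzMap ℝ ℂ) s := by
      rw [← (hasMellin_add hc1 hc2).2]
      refine integral_congr_ae (Eventually.of_forall fun v ↦ ?_)
      simp only [← hFconj, ← hFinv, smul_eq_mul]
      rw [add_comm, Complex.add_conj, mul_comm]
    _ = (∫ u, φ u * ((I * (2 * π : ℝ) * u) ^ (-s) + (I * (-(2 * π) : ℝ) * u) ^ (-s))) *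
        Complex.Gamma s := by
      rw [hfour, hinv, hm1, hm2, ← add_mul,
        ← integral_add (hint hpi) (hint (neg_ne_zero.2 hpi))]
      simp only [mul_add]
    _ = (∫ u in Set.Ioi (0 : ℝ), (2 * (2 * π : ℂ) ^ (-s) * Complex.cos (π * s / 2)) *
        (φ u * (u : ℂ) ^ (-s))) * Complex.Gamma s := by
      rw [← setIntegral_eq_integral_of_forall_compl_eq_zero (s := Set.Ioi 0)]
      · congr 1
        refine setIntegral_congr_fun measurableSet_Ioi fun u hu ↦ ?_
        simp only [I_mul_two_pi_mul_cpow_add_neg hu]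
        ring
      · intro u hu
        rw [image_eq_zero_of_notMem_tsupport fun h ↦ hu (hφsupp h), zero_mul]
    _ = _ := by
      rw [integral_const_mul]
      ring
end
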